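/- arXiv:1610.06232 — 4 statements merged into one kernel-verified Lean document; each statement's English description precedes it below -/
import Mathlib

section
/- Let x₁, x₂, x₃ ∈ ℝ² be nonzero vectors spanning ℝ², let b₁, b₂, b₃ ∈ ℝ satisfy b₁ + b₂ + b₃ = 1 and b₁x₁ + b₂x₂ + b₃x₃ = 0, and let A₁, A₂, A₃ ∈ ℝ² satisfy ⟨Aᵢ, xⱼ⟩ = ‖xⱼ‖² for all i ≠ j. Then b₁‖x₁‖²A₁ + b₂‖x₂‖²A₂ + b₃‖x₃‖²A₃ = 0. -/
open Real Set
open scoped InnerProductSpace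

noncomputable section

/-- The plane, with its Euclidean structure. -/
abbrev V2 : Type := EuclideanSpace ℝ (Fin 2)

/-- If `x` spans the space, `∑ bᵢxᵢ = 0` and `⟪Aᵢ, xⱼ⟫ = cⱼ` for `i ≠ j`, then
`∑ bᵢcᵢAᵢ = 0`. -/
theorem sum_mul_smul_eq_zero_of_inner_eq {ι E : Type*} [Fintype ι] [NormedAddCommGroup E]
    [InnerProductSpace ℝ E] {x A : ι → E} {b c : ι → ℝ}
    (hspan : Submodule.span ℝ (Set.range x) = ⊤)
    (hbx : ∑ i, b i • x i = 0)
    (hA : ∀ i j, i ≠ j → ⟪A i, x j⟫_ℝ = c j) :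
    ∑ i, (b i * c i) • A i = 0 := by
  have orthogonal_x (j : ι) : ⟪∑ i, (b i * c i) • A i, x j⟫_ℝ = 0 := by
    have swap (i : ι) : b i * c i * ⟪A i, x j⟫_ℝ = c j * (b i * ⟪A j, x i⟫_ℝ) := by
      rcases eq_or_ne i j with rfl | h
      · ring
      · rw [hA i j h, hA j i h.symm]
        ring
    calc ⟪∑ i, (b i * c i) • A i, x j⟫_ℝ = c j * ⟪A j, ∑ i, b i • x i⟫_ℝ := by
          simp only [sum_inner, inner_sum, real_inner_smul_left, real_inner_smul_right, swap,
            Finset.mul_sum]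
      _ = 0 := by rw [hbx, inner_zero_right, mul_zero]
  have inner_eq_zero : innerₗ E (∑ i, (b i * c i) • A i) = 0 :=
    LinearMap.ext_on_range hspan orthogonal_x
  exact inner_self_eq_zero.mp (LinearMap.congr_fun inner_eq_zero _)

/-- **Key identity in the proof of Theorem 1.**  If `x₁, x₂, x₃` are nonzero vectors
spanning `ℝ²`, `b₁ + b₂ + b₃ = 1`, `b₁x₁ + b₂x₂ + b₃x₃ = 0`, and `A₁, A₂, A₃` satisfy
`⟪Aᵢ, xⱼ⟫ = ‖xⱼ‖²` for `i ≠ j`, then `b₁‖x₁‖²A₁ + b₂‖x₂‖²A₂ + b₃‖x₃‖²A₃ = 0`. -/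
theorem weighted_vertex_combination_eq_zero
    (x A : Fin 3 → V2) (b : Fin 3 → ℝ)
    (hx : ∀ i, x i ≠ 0)
    (hspan : Submodule.span ℝ (Set.range x) = ⊤)
    (hb : b 0 + b 1 + b 2 = 1)
    (hbx : b 0 • x 0 + b 1 • x 1 + b 2 • x 2 = 0)
    (hA : ∀ i j : Fin 3, i ≠ j → ⟪A i, x j⟫_ℝ = ‖x j‖ ^ 2) :
    (b 0 * ‖x 0‖ ^ 2) • A 0 + (b 1 * ‖x 1‖ ^ 2) • A 1 + (b 2 * ‖x 2‖ ^ 2) • A 2 = 0 := by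
  have h := sum_mul_smul_eq_zero_of_inner_eq hspan (by rwa [Fin.sum_univ_three]) hA
  rwa [Fin.sum_univ_three] at h
end
end

section
/- Let x₁, x₂, x₃ ∈ ℝ² be nonzero vectors spanning ℝ², let b₁, b₂, b₃ > 0 satisfy b₁ + b₂ + b₃ = 1 and b₁x₁ + b₂x₂ + b₃x₃ = 0, and let A₁, A₂, A₃ ∈ ℝ² satisfy ⟨Aᵢ, xⱼ⟩ = ‖xⱼ‖² for all i ≠ j. Write rᵢ = ‖xᵢ‖ and S = b₁r₁² + b₂r₂² + b₃r₃² (> 0), and set aᵢ = bᵢrᵢ²/S. Then a₁ + a₂ + a₃ = 1 and a₁A₁ + a₂A₂ + a₃A₃ = 0; that is, (a₁, a₂, a₃) are the barycentric coordinates of the origin with respect to the triangle A₁A₂A₃. -/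
open Real Set
open scoped InnerProductSpace

noncomputable section

/-- A vector orthogonal to a spanning family vanishes. -/
theorem eq_zero_of_forall_inner_eq_zero {ι E : Type*} [NormedAddCommGroup E]
    [InnerProductSpace ℝ E] {x : ι → E} (hx : Submodule.span ℝ (Set.range x) = ⊤) {w : E}
    (hw : ∀ i, ⟪w, x i⟫_ℝ = 0) : w = 0 := by
  have h : innerₛₗ ℝ w = 0 :=
    LinearMap.ext_on_range hx fun i => by simpa using hw i
  exact (inner_self_eq_zero (𝕜 := ℝ)).mp (LinearMap.congr_fun h w)

/-- **Barycentric coordinates of the concurrency point with respect to the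
circumscribed triangle.**  With `x₁, x₂, x₃` nonzero spanning vectors, `bᵢ > 0`,
`b₁ + b₂ + b₃ = 1`, `b₁x₁ + b₂x₂ + b₃x₃ = 0` and `⟪Aᵢ, xⱼ⟫ = ‖xⱼ‖²` for `i ≠ j`,
setting `rᵢ = ‖xᵢ‖`, `S = ∑ bᵢrᵢ²` and `aᵢ = bᵢrᵢ²/S`, one has `S > 0`,
`a₁ + a₂ + a₃ = 1` and `a₁A₁ + a₂A₂ + a₃A₃ = 0`. -/
theorem barycentric_coordinates_of_origin
    (x A : Fin 3 → V2) (b : Fin 3 → ℝ)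
    (hx : ∀ i, x i ≠ 0)
    (hspan : Submodule.span ℝ (Set.range x) = ⊤)
    (hbpos : ∀ i, 0 < b i)
    (hb : b 0 + b 1 + b 2 = 1)
    (hbx : b 0 • x 0 + b 1 • x 1 + b 2 • x 2 = 0)
    (hA : ∀ i j : Fin 3, i ≠ j → ⟪A i, x j⟫_ℝ = ‖x j‖ ^ 2)
    (r : Fin 3 → ℝ) (hr : ∀ i, r i = ‖x i‖)
    (S : ℝ) (hS : S = b 0 * r 0 ^ 2 + b 1 * r 1 ^ 2 + b 2 * r 2 ^ 2)
    (a : Fin 3 → ℝ) (ha : ∀ i, a i = b i * r i ^ 2 / S) :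
    0 < S ∧ a 0 + a 1 + a 2 = 1 ∧ a 0 • A 0 + a 1 • A 1 + a 2 • A 2 = 0 := by
  obtain rfl : r = fun i => ‖x i‖ := funext hr
  obtain rfl : a = fun i => b i * ‖x i‖ ^ 2 / S := funext ha
  have hterm (i : Fin 3) : 0 < b i * ‖x i‖ ^ 2 :=
    mul_pos (hbpos i) (pow_pos (norm_pos_iff.mpr (hx i)) 2)
  have hSpos : 0 < S := by
    rw [hS]
    exact add_pos (add_pos (hterm 0) (hterm 1)) (hterm 2)
  refine ⟨hSpos, ?_, ?_⟩
  · simp only [← add_div, ← hS, div_self hSpos.ne']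
  · have hrel (i : Fin 3) :
        b 0 * ⟪A i, x 0⟫_ℝ + b 1 * ⟪A i, x 1⟫_ℝ + b 2 * ⟪A i, x 2⟫_ℝ = 0 := by
      simpa only [inner_add_right, real_inner_smul_right, inner_zero_right]
        using congrArg (fun v => ⟪A i, v⟫_ℝ) hbx
    refine eq_zero_of_forall_inner_eq_zero hspan fun j => ?_
    have h0 := hrel 0
    have h1 := hrel 1
    have h2 := hrel 2
    rw [hA 0 1 (by decide), hA 0 2 (by decide)] at h0
    rw [hA 1 0 (by decide), hA 1 2 (by decide)] at h1
    rw [hA 2 0 (by decide), hA 2 1 (by decide)] at h2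
    simp only [inner_add_left, real_inner_smul_left]
    field_simp
    fin_cases j <;> dsimp only [Fin.zero_eta, Fin.mk_one, Fin.reduceFinMk]
    · rw [hA 1 0 (by decide), hA 2 0 (by decide)]
      linear_combination ‖x 0‖ ^ 2 * h0
    · rw [hA 0 1 (by decide), hA 2 1 (by decide)]
      linear_combination ‖x 1‖ ^ 2 * h1
    · rw [hA 0 2 (by decide), hA 1 2 (by decide)]
      linear_combination ‖x 2‖ ^ 2 * h2
end
end

section
/- Let x₁, x₂, x₃ ∈ ℝ² be nonzero vectors, let b₁, b₂, b₃ > 0 satisfy b₁ + b₂ + b₃ = 1 and b₁x₁ + b₂x₂ + b₃x₃ = 0, let c ∈ ℝ², and write rᵢ = ‖xᵢ‖. Suppose κ₁, κ₂, κ₃ > 0 satisfy 1/κᵢ = rᵢ + ⟨c, xᵢ⟩/rᵢ for i = 1, 2, 3. Set S = b₁r₁² + b₂r₂² + b₃r₃² and aᵢ = bᵢrᵢ²/S. Then a₁/(κ₁r₁) + a₂/(κ₂r₂) + a₃/(κ₃r₃) = 1. -/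
open Real Set
open scoped InnerProductSpace

noncomputable section

/-- **Algebraic core of Theorem 1.**  If `x₁, x₂, x₃` are nonzero, `bᵢ > 0` with
`b₁ + b₂ + b₃ = 1` and `b₁x₁ + b₂x₂ + b₃x₃ = 0`, and the curvatures satisfy
`1/κᵢ = rᵢ + ⟪c, xᵢ⟫/rᵢ` where `rᵢ = ‖xᵢ‖`, then with `S = ∑ bᵢrᵢ²` and
`aᵢ = bᵢrᵢ²/S` one has `a₁/(κ₁r₁) + a₂/(κ₂r₂) + a₃/(κ₃r₃) = 1`. -/
theorem barycentric_curvature_formula_core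
    (x : Fin 3 → V2) (hx : ∀ i, x i ≠ 0)
    (b : Fin 3 → ℝ) (hbpos : ∀ i, 0 < b i)
    (hb : b 0 + b 1 + b 2 = 1)
    (hbx : b 0 • x 0 + b 1 • x 1 + b 2 • x 2 = 0)
    (c : V2)
    (r : Fin 3 → ℝ) (hr : ∀ i, r i = ‖x i‖)
    (κ : Fin 3 → ℝ) (hκpos : ∀ i, 0 < κ i)
    (hκ : ∀ i, (κ i)⁻¹ = r i + ⟪c, x i⟫_ℝ / r i)
    (S : ℝ) (hS : S = b 0 * r 0 ^ 2 + b 1 * r 1 ^ 2 + b 2 * r 2 ^ 2)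
    (a : Fin 3 → ℝ) (ha : ∀ i, a i = b i * r i ^ 2 / S) :
    a 0 / (κ 0 * r 0) + a 1 / (κ 1 * r 1) + a 2 / (κ 2 * r 2) = 1 := by
  have hrpos : ∀ i, 0 < r i := fun i => hr i ▸ norm_pos_iff.mpr (hx i)
  have hSpos : 0 < S := by
    have h : ∀ i, 0 < b i * r i ^ 2 := fun i => mul_pos (hbpos i) (pow_pos (hrpos i) 2)
    linarith [h 0, h 1, h 2]
  have hterm : ∀ i, a i / (κ i * r i) = (b i * r i ^ 2 + b i * ⟪c, x i⟫_ℝ) / S := by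
    intro i
    have hri := (hrpos i).ne'
    rw [div_eq_mul_inv, mul_inv, hκ i, ha i]
    field_simp
  have hinner : b 0 * ⟪c, x 0⟫_ℝ + b 1 * ⟪c, x 1⟫_ℝ + b 2 * ⟪c, x 2⟫_ℝ = 0 := by
    simpa only [inner_add_right, real_inner_smul_right, inner_zero_right] using
      congrArg (fun v => ⟪c, v⟫_ℝ) hbx
  rw [hterm, hterm, hterm, ← add_div, ← add_div, div_eq_one_iff_eq hSpos.ne']
  linarith
end
end

section
/- Let T ⊆ ℝ³ be a tetrahedron and let x₁, x₂, x₃, x₄ be four points lying in the relative interiors of the four faces of T, one in each face. Let Lᵢ be the normal line to T at xᵢ, i.e. the line through xᵢ perpendicular to the plane of the face containing xᵢ, and assume L₁, L₂, L₃, L₄ are directionally independent. Then {x₁, x₂, x₃, x₄} immobilizes T if and only if the lines L₁, L₂, L₃, L₄ belong generically to one ruling of a quadric surface. -/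
open Real Set
open scoped InnerProductSpace

noncomputable section

/-- Euclidean 3-space. -/
abbrev V3 : Type := EuclideanSpace ℝ (Fin 3)

/-- The line through `p` with direction `d`. -/
def lineTh (p d : V3) : Set V3 := {q | ∃ t : ℝ, q = p + t • d}

/-- Four lines (given by points `p i` and directions `d i`) are directionally
independent: no two of them are parallel. -/
def DirIndep (d : Fin 4 → V3) : Prop :=
  ∀ i j : Fin 4, i ≠ j → LinearIndependent ℝ ![d i, d j]

/-- Four directionally independent lines belong generically to one ruling of a quadric
surface: they are concurrent; or they are pairwise disjoint and lie on a quadric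
surface (the zero set of a nonzero polynomial of degree at most 2); or they meet in
pairs and the two planes these pairs generate meet in the line through the two
intersection points. -/
def GenOneRuling (p d : Fin 4 → V3) : Prop :=
  (∃ q : V3, ∀ i, q ∈ lineTh (p i) (d i)) ∨
  ((∀ i j : Fin 4, i ≠ j → lineTh (p i) (d i) ∩ lineTh (p j) (d j) = ∅) ∧
    ∃ Q : MvPolynomial (Fin 3) ℝ, Q ≠ 0 ∧ Q.totalDegree ≤ 2 ∧
      ∀ i, ∀ y ∈ lineTh (p i) (d i), MvPolynomial.eval (fun j => y j) Q = 0) ∨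
  (∃ σ : Equiv.Perm (Fin 4), ∃ q₁ q₂ : V3, q₁ ≠ q₂ ∧
    q₁ ∈ lineTh (p (σ 0)) (d (σ 0)) ∩ lineTh (p (σ 1)) (d (σ 1)) ∧
    q₂ ∈ lineTh (p (σ 2)) (d (σ 2)) ∩ lineTh (p (σ 3)) (d (σ 3)) ∧
    affineSpan ℝ (lineTh (p (σ 0)) (d (σ 0)) ∪ lineTh (p (σ 1)) (d (σ 1))) ⊓
      affineSpan ℝ (lineTh (p (σ 2)) (d (σ 2)) ∪ lineTh (p (σ 3)) (d (σ 3))) =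
      affineSpan ℝ ({q₁, q₂} : Set V3))

/-- A set `X` of points immobilizes the convex body `Φ ⊆ ℝ³`: every
orientation-preserving isometry `q ↦ ρ q + v` close enough to the identity but
different from it moves `Φ` so that some point of `X` penetrates its interior. -/
def Immobilizes3 (X Φ : Set V3) : Prop :=
  ∃ ε > (0 : ℝ), ∀ (ρ : V3 ≃ₗᵢ[ℝ] V3) (v : V3),
    0 < LinearMap.det (ρ.toLinearEquiv : V3 →ₗ[ℝ] V3) →
    (∀ y : V3, ‖ρ y - y‖ ≤ ε * ‖y‖) → ‖v‖ < ε →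
    (∃ q : V3, ρ q + v ≠ q) →
    ∃ x ∈ X, x ∈ interior ((fun q => ρ q + v) '' Φ)

lemma exists_eq_sum_coords (f : V3 →ₗ[ℝ] ℝ) : ∃ c : Fin 3 → ℝ, ∀ y : V3, f y = ∑ k, c k * y k := by
  refine ⟨fun k => f (EuclideanSpace.single k 1), fun y => ?_⟩
  have hy : y = ∑ k, y k • EuclideanSpace.single k (1 : ℝ) := by
    ext k
    fin_cases k <;> simp [Fin.sum_univ_three]
  conv_lhs => rw [hy, map_sum]
  simp [mul_comm]

/-- The moments of the lines through `x i` with directions `n i` add up to zero. -/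
def MomentBalanced (x n : Fin 4 → V3) : Prop :=
  ∀ f g : V3 →ₗ[ℝ] ℝ, ∑ i, (f (x i) * g (n i) - g (x i) * f (n i)) = 0

/-- Four vectors adding up to zero, every linear relation between which is a multiple of that
one. -/
structure ClosedFrame (n : Fin 4 → V3) : Prop where
  sum_eq_zero : ∑ i, n i = 0
  eq_of_relation : ∀ c : Fin 4 → ℝ, ∑ i, c i • n i = 0 → ∀ i j, c i = c j

lemma ClosedFrame.comp_perm {n : Fin 4 → V3} (hn : ClosedFrame n) (σ : Equiv.Perm (Fin 4)) :
    ClosedFrame (n ∘ σ) where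
  sum_eq_zero := by
    rw [← hn.sum_eq_zero]
    exact Equiv.sum_comp σ n
  eq_of_relation c hc i j := by
    have h := hn.eq_of_relation (c ∘ σ.symm) (by
      rw [← hc, ← Equiv.sum_comp σ]
      simp) (σ i) (σ j)
    simpa using h

lemma MomentBalanced.comp_perm {x n : Fin 4 → V3} (h : MomentBalanced x n)
    (σ : Equiv.Perm (Fin 4)) : MomentBalanced (x ∘ σ) (n ∘ σ) := fun f g => by
  rw [← h f g]
  exact Equiv.sum_comp σ (fun i => f (x i) * g (n i) - g (x i) * f (n i))

lemma balanced_comp_perm_iff {x n : Fin 4 → V3} (σ : Equiv.Perm (Fin 4)) :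
    MomentBalanced (x ∘ σ) (n ∘ σ) ↔ MomentBalanced x n := by
  refine ⟨fun h => ?_, fun h => h.comp_perm σ⟩
  have := h.comp_perm σ.symm
  simpa [Function.comp_assoc] using this

/-- Linear coordinates with respect to the basis `n 1, n 2, n 3`. -/
structure FrameCoords (n : Fin 4 → V3) (X Y Z : V3 →ₗ[ℝ] ℝ) : Prop where
  eq_sum : ∀ w, w = X w • n 1 + Y w • n 2 + Z w • n 3
  X0 : X (n 0) = -1
  X1 : X (n 1) = 1
  X2 : X (n 2) = 0
  X3 : X (n 3) = 0
  Y0 : Y (n 0) = -1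
  Y1 : Y (n 1) = 0
  Y2 : Y (n 2) = 1
  Y3 : Y (n 3) = 0
  Z0 : Z (n 0) = -1
  Z1 : Z (n 1) = 0
  Z2 : Z (n 2) = 0
  Z3 : Z (n 3) = 1

lemma ClosedFrame.exists_coords {n : Fin 4 → V3} (hn : ClosedFrame n) :
    ∃ X Y Z, FrameCoords n X Y Z := by
  have hli : LinearIndependent ℝ ![n 1, n 2, n 3] := by
    rw [Fintype.linearIndependent_iff]
    intro g hg i
    have h := fun i => hn.eq_of_relation ![0, g 0, g 1, g 2] (by
      simpa [Fin.sum_univ_succ] using hg) i 0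
    fin_cases i
    · simpa using h 1
    · simpa using h 2
    · simpa using h 3
  let e := basisOfLinearIndependentOfCardEqFinrank hli (by simp)
  have h1 : e 0 = n 1 := by simp [e]
  have h2 : e 1 = n 2 := by simp [e]
  have h3 : e 2 = n 3 := by simp [e]
  have h0 : n 0 = -(e 0 + e 1 + e 2) := by
    have := hn.sum_eq_zero
    rw [Fin.sum_univ_four] at this
    rw [h1, h2, h3]
    linear_combination (norm := module) this
  refine ⟨e.coord 0, e.coord 1, e.coord 2, ?_⟩
  constructor
  · intro w
    rw [← h1, ← h2, ← h3]
    conv_lhs => rw [← e.sum_repr w, Fin.sum_univ_three]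
    rfl
  all_goals first | rw [h0] | rw [← h1] | rw [← h2] | rw [← h3]
  all_goals simp

section coords

variable {n x : Fin 4 → V3} {X Y Z : V3 →ₗ[ℝ] ℝ}

lemma FrameCoords.ext (h : FrameCoords n X Y Z) {w w' : V3} (hX : X w = X w') (hY : Y w = Y w')
    (hZ : Z w = Z w') : w = w' := by
  rw [h.eq_sum w, h.eq_sum w', hX, hY, hZ]

lemma FrameCoords.sum_eq_zero (h : FrameCoords n X Y Z) : n 0 + n 1 + n 2 + n 3 = 0 := by
  apply h.ext <;>
  simp [h.X0, h.X1, h.X2, h.X3, h.Y0, h.Y1, h.Y2, h.Y3, h.Z0, h.Z1, h.Z2, h.Z3]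

/-- The balance condition in coordinates. -/
lemma FrameCoords.balanced_iff (h : FrameCoords n X Y Z) :
    MomentBalanced x n ↔
      Y (x 0) - X (x 0) - Y (x 1) + X (x 2) = 0 ∧
      Z (x 0) - Y (x 0) - Z (x 2) + Y (x 3) = 0 ∧
      X (x 0) - Z (x 0) - X (x 3) + Z (x 1) = 0 := by
  constructor
  · intro hb
    have h1 := hb X Y
    have h2 := hb Y Z
    have h3 := hb Z X
    simp only [Fin.sum_univ_four, h.X0, h.X1, h.X2, h.X3, h.Y0, h.Y1, h.Y2, h.Y3,
      h.Z0, h.Z1, h.Z2, h.Z3] at h1 h2 h3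
    refine ⟨?_, ?_, ?_⟩ <;> linarith
  · rintro ⟨h1, h2, h3⟩ f g
    have hf : ∀ w, f w = X w * f (n 1) + Y w * f (n 2) + Z w * f (n 3) := fun w => by
      conv_lhs => rw [h.eq_sum w]
      simp
    have hg : ∀ w, g w = X w * g (n 1) + Y w * g (n 2) + Z w * g (n 3) := fun w => by
      conv_lhs => rw [h.eq_sum w]
      simp
    rw [Fin.sum_univ_four, hf (x 0), hf (x 1), hf (x 2), hf (x 3), hg (x 0), hg (x 1), hg (x 2),
      hg (x 3), hf (n 0), hg (n 0), h.X0, h.Y0, h.Z0]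
    linear_combination (f (n 1) * g (n 2) - f (n 2) * g (n 1)) * h1 +
      (f (n 2) * g (n 3) - f (n 3) * g (n 2)) * h2 + (f (n 3) * g (n 1) - f (n 1) * g (n 3)) * h3

end coords

lemma balanced_of_concurrent {x n : Fin 4 → V3} (hn : ∑ i, n i = 0) {q : V3}
    (hq : ∀ i, q ∈ lineTh (x i) (n i)) : MomentBalanced x n := by
  intro f g
  choose t ht using hq
  have hf : ∀ i, f (x i) = f q - t i * f (n i) := fun i => by
    rw [ht i]; simp
  have hg : ∀ i, g (x i) = g q - t i * g (n i) := fun i => by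
    rw [ht i]; simp
  have h1 : ∑ i, f (n i) = 0 := by rw [← map_sum, hn, map_zero]
  have h2 : ∑ i, g (n i) = 0 := by rw [← map_sum, hn, map_zero]
  simp only [hf, hg]
  calc _ = f q * ∑ i, g (n i) - g q * ∑ i, f (n i) := by
        rw [Finset.mul_sum, Finset.mul_sum, ← Finset.sum_sub_distrib]
        exact Finset.sum_congr rfl fun i _ => by ring
    _ = 0 := by rw [h1, h2]; ring

lemma mem_affineSpan_lineTh_union {p p' d d' q y : V3} (hq : q ∈ lineTh p d)
    (hq' : q ∈ lineTh p' d') :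
    y ∈ affineSpan ℝ (lineTh p d ∪ lineTh p' d') ↔ ∃ a b : ℝ, y = q + a • d + b • d' := by
  obtain ⟨t, ht⟩ := hq
  obtain ⟨s, hs⟩ := hq'
  have : affineSpan ℝ (lineTh p d ∪ lineTh p' d') =
      AffineSubspace.mk' q (Submodule.span ℝ {d, d'}) := by
    apply le_antisymm
    · rw [affineSpan_le]
      rintro z (⟨r, rfl⟩ | ⟨r, rfl⟩)
      · rw [SetLike.mem_coe, AffineSubspace.mem_mk', vsub_eq_sub, Submodule.mem_span_pair]
        exact ⟨r - t, 0, by rw [ht]; module⟩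
      · rw [SetLike.mem_coe, AffineSubspace.mem_mk', vsub_eq_sub, Submodule.mem_span_pair]
        exact ⟨0, r - s, by rw [hs]; module⟩
    · intro z hz
      rw [AffineSubspace.mem_mk', vsub_eq_sub, Submodule.mem_span_pair] at hz
      obtain ⟨a, b, hab⟩ := hz
      have m0 : q ∈ affineSpan ℝ (lineTh p d ∪ lineTh p' d') :=
        subset_affineSpan _ _ (Or.inl ⟨t, ht⟩)
      have m1 : q + a • d ∈ affineSpan ℝ (lineTh p d ∪ lineTh p' d') :=
        subset_affineSpan _ _ (Or.inl ⟨t + a, by rw [ht]; module⟩)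
      have m2 : q + b • d' ∈ affineSpan ℝ (lineTh p d ∪ lineTh p' d') :=
        subset_affineSpan _ _ (Or.inr ⟨s + b, by rw [hs]; module⟩)
      have := AffineSubspace.smul_vsub_vadd_mem _ (1 : ℝ) m1 m0 m2
      have e : z = (1 : ℝ) • ((q + a • d) -ᵥ q) +ᵥ (q + b • d') := by
        rw [vsub_eq_sub, vadd_eq_add]
        linear_combination (norm := module) -hab
      rw [e]
      exact this
  rw [this, AffineSubspace.mem_mk', vsub_eq_sub, Submodule.mem_span_pair]
  constructor
  · rintro ⟨a, b, hab⟩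
    exact ⟨a, b, by rw [add_assoc, hab]; abel⟩
  · rintro ⟨a, b, rfl⟩
    exact ⟨a, b, by abel⟩

/-- If the lines `0` and `1` meet in `q₁`, the lines `2` and `3` in `q₂`, and the planes they span
meet in the line through `q₁` and `q₂`, then the moments are balanced. -/
lemma balanced_of_planes {x n : Fin 4 → V3} (hn : ClosedFrame n) {q₁ q₂ : V3}
    (h0 : q₁ ∈ lineTh (x 0) (n 0)) (h1 : q₁ ∈ lineTh (x 1) (n 1))
    (h2 : q₂ ∈ lineTh (x 2) (n 2)) (h3 : q₂ ∈ lineTh (x 3) (n 3))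
    (h : affineSpan ℝ (lineTh (x 0) (n 0) ∪ lineTh (x 1) (n 1)) ⊓
      affineSpan ℝ (lineTh (x 2) (n 2) ∪ lineTh (x 3) (n 3)) =
      affineSpan ℝ ({q₁, q₂} : Set V3)) : MomentBalanced x n := by
  obtain ⟨X, Y, Z, hc⟩ := hn.exists_coords
  have e1 : q₁ ∈ affineSpan ℝ ({q₁, q₂} : Set V3) := left_mem_affineSpan_pair ℝ q₁ q₂
  have e2 : q₂ ∈ affineSpan ℝ ({q₁, q₂} : Set V3) := right_mem_affineSpan_pair ℝ q₁ q₂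
  rw [← h] at e1 e2
  obtain ⟨a, b, hab⟩ := (mem_affineSpan_lineTh_union h0 h1).1 e2.1
  obtain ⟨c, e, hce⟩ := (mem_affineSpan_lineTh_union h2 h3).1 e1.2
  obtain ⟨t0, h0⟩ := h0
  obtain ⟨t1, h1⟩ := h1
  obtain ⟨t2, h2⟩ := h2
  obtain ⟨t3, h3⟩ := h3
  rw [hc.balanced_iff]
  have key : ∀ f : V3 →ₗ[ℝ] ℝ, f q₂ = f q₁ + a * f (n 0) + b * f (n 1) ∧
      f q₁ = f q₂ + c * f (n 2) + e * f (n 3) ∧ f q₁ = f (x 0) + t0 * f (n 0) ∧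
      f q₁ = f (x 1) + t1 * f (n 1) ∧ f q₂ = f (x 2) + t2 * f (n 2) ∧
      f q₂ = f (x 3) + t3 * f (n 3) := fun f =>
    ⟨by conv_lhs => rw [hab]
        simp,
     by conv_lhs => rw [hce]
        simp,
     by rw [h0]; simp, by rw [h1]; simp, by rw [h2]; simp, by rw [h3]; simp⟩
  obtain ⟨a1, a2, a3, a4, a5, a6⟩ := key X
  obtain ⟨b1, b2, b3, b4, b5, b6⟩ := key Y
  obtain ⟨c1, c2, c3, c4, c5, c6⟩ := key Z
  simp only [hc.X0, hc.X1, hc.X2, hc.X3, hc.Y0, hc.Y1, hc.Y2, hc.Y3,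
      hc.Z0, hc.Z1, hc.Z2, hc.Z3] at *
  refine ⟨?_, ?_, ?_⟩ <;> linarith

/-- Lines with balanced moments, two of which meet, are concurrent or meet in pairs. -/
lemma concurrent_or_planes_of_balanced {x n : Fin 4 → V3} (hn : ClosedFrame n)
    (hb : MomentBalanced x n) {q₁ : V3}
    (h0 : q₁ ∈ lineTh (x 0) (n 0)) (h1 : q₁ ∈ lineTh (x 1) (n 1)) :
    (∀ i, q₁ ∈ lineTh (x i) (n i)) ∨ ∃ q₂, q₁ ≠ q₂ ∧
      q₂ ∈ lineTh (x 2) (n 2) ∧ q₂ ∈ lineTh (x 3) (n 3) ∧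
      affineSpan ℝ (lineTh (x 0) (n 0) ∪ lineTh (x 1) (n 1)) ⊓
      affineSpan ℝ (lineTh (x 2) (n 2) ∪ lineTh (x 3) (n 3)) =
      affineSpan ℝ ({q₁, q₂} : Set V3) := by
  obtain ⟨X, Y, Z, hc⟩ := hn.exists_coords
  obtain ⟨e1, e2, e3⟩ := hc.balanced_iff.1 hb
  have h0' := h0
  have h1' := h1
  obtain ⟨t0, h0⟩ := h0
  obtain ⟨t1, h1⟩ := h1
  have key : ∀ f : V3 →ₗ[ℝ] ℝ, f q₁ = f (x 0) + t0 * f (n 0) ∧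
      f q₁ = f (x 1) + t1 * f (n 1) := fun f => ⟨by rw [h0]; simp, by rw [h1]; simp⟩
  obtain ⟨a3, a4⟩ := key X
  obtain ⟨b3, b4⟩ := key Y
  obtain ⟨c3, c4⟩ := key Z
  simp only [hc.X0, hc.X1, hc.Y0, hc.Y1, hc.Z0, hc.Z1] at *
  set r := Z (x 2) - Z q₁ with hr
  have h2 : q₁ + r • (n 2 + n 3) ∈ lineTh (x 2) (n 2) := by
    refine ⟨Y q₁ + r - Y (x 2), hc.ext ?_ ?_ ?_⟩ <;>
    simp [hc.X2, hc.X3, hc.Y2, hc.Y3, hc.Z2, hc.Z3] <;> linarith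
  have h3 : q₁ + r • (n 2 + n 3) ∈ lineTh (x 3) (n 3) := by
    refine ⟨Z q₁ + r - Z (x 3), hc.ext ?_ ?_ ?_⟩ <;>
    simp [hc.X2, hc.X3, hc.Y2, hc.Y3, hc.Z2, hc.Z3] <;> linarith
  by_cases hr0 : r = 0
  · left
    simp only [hr0, zero_smul, add_zero] at h2 h3
    intro i
    fin_cases i <;> assumption
  · right
    refine ⟨_, ?_, h2, h3, ?_⟩
    · intro h
      have := congrArg Y h
      simp [hc.Y2, hc.Y3, hr0] at this
    · ext y
      rw [AffineSubspace.mem_inf_iff, mem_affineSpan_lineTh_union h0' h1',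
        mem_affineSpan_lineTh_union h2 h3, mem_affineSpan_pair_iff_exists_lineMap_eq]
      have hs := hc.sum_eq_zero
      constructor
      · rintro ⟨⟨a, b, hab⟩, c, e, hce⟩
        refine ⟨-a / r, ?_⟩
        have hx' := congrArg X hab
        have hx := congrArg X hce
        have hy' := congrArg Y hab
        have hz' := congrArg Z hab
        simp [hc.X0, hc.X1, hc.X2, hc.X3, hc.Y0, hc.Y1, hc.Z0, hc.Z1] at hx hx' hy' hz'
        rw [AffineMap.lineMap_apply, vsub_eq_sub, vadd_eq_add]
        apply hc.ext <;> simp [hc.X2, hc.X3, hc.Y2, hc.Y3, hc.Z2, hc.Z3]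
        · linarith
        · field_simp; linarith
        · field_simp; linarith
      · rintro ⟨s, rfl⟩
        rw [AffineMap.lineMap_apply, vsub_eq_sub, vadd_eq_add]
        refine ⟨⟨-s * r, -s * r, ?_⟩, s * r - r, s * r - r, ?_⟩
        · linear_combination (norm := module) (s * r) • hs
        · module

section skew

variable {n x : Fin 4 → V3} {X Y Z : V3 →ₗ[ℝ] ℝ}

lemma not_meet_of_inter_eq_empty {p p' d d' : V3} (h : lineTh p d ∩ lineTh p' d' = ∅) (s t : ℝ) :
    p + s • d ≠ p' + t • d' := fun e =>
  Set.notMem_empty (p + s • d) (h ▸ ⟨⟨s, rfl⟩, ⟨t, e⟩⟩)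

/-- What disjointness of the lines means in coordinates. -/
lemma FrameCoords.ne_of_disjoint (hc : FrameCoords n X Y Z)
    (hd : ∀ i j : Fin 4, i ≠ j → lineTh (x i) (n i) ∩ lineTh (x j) (n j) = ∅) :
    Z (x 1) ≠ Z (x 2) ∧ X (x 2) ≠ X (x 3) ∧ Y (x 1) ≠ Y (x 3) ∧
    Y (x 0) - Z (x 0) ≠ Y (x 1) - Z (x 1) ∧ Z (x 0) - X (x 0) ≠ Z (x 2) - X (x 2) ∧
    X (x 0) - Y (x 0) ≠ X (x 3) - Y (x 3) := by
  refine ⟨fun h => ?_, fun h => ?_, fun h => ?_, fun h => ?_, fun h => ?_, fun h => ?_⟩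
  · refine not_meet_of_inter_eq_empty (hd 1 2 (by decide)) (X (x 2) - X (x 1)) (Y (x 1) - Y (x 2))
      (hc.ext ?_ ?_ ?_) <;> simp [hc.X1, hc.X2, hc.Y1, hc.Y2, hc.Z1, hc.Z2, h]
  · refine not_meet_of_inter_eq_empty (hd 2 3 (by decide)) (Y (x 3) - Y (x 2)) (Z (x 2) - Z (x 3))
      (hc.ext ?_ ?_ ?_) <;> simp [hc.X3, hc.X2, hc.Y3, hc.Y2, hc.Z3, hc.Z2, h]
  · refine not_meet_of_inter_eq_empty (hd 1 3 (by decide)) (X (x 3) - X (x 1)) (Z (x 1) - Z (x 3))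
      (hc.ext ?_ ?_ ?_) <;> simp [hc.X1, hc.X3, hc.Y1, hc.Y3, hc.Z1, hc.Z3, h]
  · refine not_meet_of_inter_eq_empty (hd 0 1 (by decide)) (Y (x 0) - Y (x 1))
      (X (x 0) - (Y (x 0) - Y (x 1)) - X (x 1))
      (hc.ext ?_ ?_ ?_) <;> simp [hc.X0, hc.X1, hc.Y0, hc.Y1, hc.Z0, hc.Z1] <;> linarith
  · refine not_meet_of_inter_eq_empty (hd 0 2 (by decide)) (X (x 0) - X (x 2))
      (Y (x 0) - (X (x 0) - X (x 2)) - Y (x 2))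
      (hc.ext ?_ ?_ ?_) <;> simp [hc.X0, hc.X2, hc.Y0, hc.Y2, hc.Z0, hc.Z2] <;> linarith
  · refine not_meet_of_inter_eq_empty (hd 0 3 (by decide)) (X (x 0) - X (x 3))
      (Z (x 0) - (X (x 0) - X (x 3)) - Z (x 3))
      (hc.ext ?_ ?_ ?_) <;> simp [hc.X0, hc.X3, hc.Y0, hc.Y3, hc.Z0, hc.Z3] <;> linarith

lemma exists_mvPolynomial_eval_eq (f : V3 →ₗ[ℝ] ℝ) (c : ℝ) :
    ∃ P : MvPolynomial (Fin 3) ℝ, P.totalDegree ≤ 1 ∧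
      ∀ y : V3, MvPolynomial.eval (fun j => y j) P = f y - c := by
  obtain ⟨k, hk⟩ := exists_eq_sum_coords f
  refine ⟨∑ j, MvPolynomial.C (k j) * MvPolynomial.X j - MvPolynomial.C c, ?_, fun y => ?_⟩
  · refine (MvPolynomial.totalDegree_sub _ _).trans (max_le ?_ (by simp))
    refine MvPolynomial.totalDegree_finsetSum_le fun j _ => ?_
    refine (MvPolynomial.totalDegree_mul _ _).trans ?_
    simp
  · rw [hk]
    simp

/-- Pairwise disjoint lines with balanced moments lie on a quadric. -/
lemma exists_quadric_of_balanced (hn : ClosedFrame n) (hb : MomentBalanced x n)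
    (hd : ∀ i j : Fin 4, i ≠ j → lineTh (x i) (n i) ∩ lineTh (x j) (n j) = ∅) :
    ∃ Q : MvPolynomial (Fin 3) ℝ, Q ≠ 0 ∧ Q.totalDegree ≤ 2 ∧
      ∀ i, ∀ y ∈ lineTh (x i) (n i), MvPolynomial.eval (fun j => y j) Q = 0 := by
  obtain ⟨X, Y, Z, hc⟩ := hn.exists_coords
  obtain ⟨e1, e2, e3⟩ := hc.balanced_iff.1 hb
  obtain ⟨dz, dx, dy, -⟩ := hc.ne_of_disjoint hd
  obtain ⟨P1, hP1, E1⟩ := exists_mvPolynomial_eval_eq X ((X (x 2) + X (x 3)) / 2)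
  obtain ⟨P2, hP2, E2⟩ := exists_mvPolynomial_eval_eq Y ((Y (x 1) + Y (x 3)) / 2)
  obtain ⟨P3, hP3, E3⟩ := exists_mvPolynomial_eval_eq Z ((Z (x 1) + Z (x 2)) / 2)
  set hx := (X (x 3) - X (x 2)) / 2 with hhx
  set hy := (Y (x 1) - Y (x 3)) / 2 with hhy
  set hz := (Z (x 2) - Z (x 1)) / 2 with hhz
  have hE : ∀ y : V3, MvPolynomial.eval (fun j => y j) (MvPolynomial.C hz * (P1 * P2) +
      MvPolynomial.C hx * (P2 * P3) + MvPolynomial.C hy * (P3 * P1) +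
      MvPolynomial.C (hx * hy * hz)) =
      hz * ((X y - (X (x 2) + X (x 3)) / 2) * (Y y - (Y (x 1) + Y (x 3)) / 2)) +
      hx * ((Y y - (Y (x 1) + Y (x 3)) / 2) * (Z y - (Z (x 1) + Z (x 2)) / 2)) +
      hy * ((Z y - (Z (x 1) + Z (x 2)) / 2) * (X y - (X (x 2) + X (x 3)) / 2)) + hx * hy * hz :=
    fun y => by simp only [map_add, map_mul, E1, E2, E3, MvPolynomial.eval_C]
  refine ⟨MvPolynomial.C hz * (P1 * P2) + MvPolynomial.C hx * (P2 * P3) +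
      MvPolynomial.C hy * (P3 * P1) + MvPolynomial.C (hx * hy * hz), fun h0 => ?_, ?_,
      fun i y hy => ?_⟩
  · have := hE (((X (x 2) + X (x 3)) / 2) • n 1 + ((Y (x 1) + Y (x 3)) / 2) • n 2 +
      ((Z (x 1) + Z (x 2)) / 2) • n 3)
    rw [h0] at this
    simp [hc.X1, hc.X2, hc.X3, hc.Y1, hc.Y2, hc.Y3, hc.Z1, hc.Z2, hc.Z3] at this
    rcases this with (h | h) | h
    · exact dx (by linarith)
    · exact dy (by linarith)
    · exact dz (by linarith)
  · have hmul : ∀ (c : ℝ) (P P' : MvPolynomial (Fin 3) ℝ), P.totalDegree ≤ 1 →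
        P'.totalDegree ≤ 1 → (MvPolynomial.C c * (P * P')).totalDegree ≤ 2 :=
      fun c P P' h h' => by
        refine (MvPolynomial.totalDegree_mul _ _).trans ?_
        rw [MvPolynomial.totalDegree_C, zero_add]
        exact (MvPolynomial.totalDegree_mul _ _).trans (by omega)
    refine (MvPolynomial.totalDegree_add _ _).trans
      (max_le ?_ ((MvPolynomial.totalDegree_C _).le.trans zero_le_two))
    refine (MvPolynomial.totalDegree_add _ _).trans (max_le ?_ (hmul _ _ _ hP3 hP1))
    exact (MvPolynomial.totalDegree_add _ _).trans
      (max_le (hmul _ _ _ hP1 hP2) (hmul _ _ _ hP2 hP3))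
  · obtain ⟨t, rfl⟩ := hy
    rw [hE]
    fin_cases i
    · simp only [map_add, map_smul, hc.X0, hc.Y0, hc.Z0, smul_eq_mul, Fin.zero_eta]
      have k1 : hx = Y (x 0) - Z (x 0) - (Y (x 1) + Y (x 3)) / 2 + (Z (x 1) + Z (x 2)) / 2 := by
        linarith
      have k2 : hy = Z (x 0) - X (x 0) - (Z (x 1) + Z (x 2)) / 2 + (X (x 2) + X (x 3)) / 2 := by
        linarith
      have k3 : hz = X (x 0) - Y (x 0) - (X (x 2) + X (x 3)) / 2 + (Y (x 1) + Y (x 3)) / 2 := by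
        linarith
      rw [k1, k2, k3]
      ring
    · simp [hc.X1, hc.Y1, hc.Z1, hhx, hhy, hhz]
      ring
    · simp [hc.X2, hc.Y2, hc.Z2, hhx, hhy, hhz]
      ring
    · simp [hc.X3, hc.Y3, hc.Z3, hhx, hhy, hhz]
      ring

/-- Polynomial functions of degree at most two in three variables. -/
def IsQuadFun (G : ℝ → ℝ → ℝ → ℝ) : Prop :=
  ∃ k₀ k₁ k₂ k₃ k₁₁ k₂₂ k₃₃ k₁₂ k₂₃ k₃₁ : ℝ, ∀ a b c,
    G a b c = k₀ + k₁ * a + k₂ * b + k₃ * c + k₁₁ * a ^ 2 + k₂₂ * b ^ 2 + k₃₃ * c ^ 2 +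
      k₁₂ * (a * b) + k₂₃ * (b * c) + k₃₁ * (c * a)

lemma isQuadFun_sum {ι : Type*} (s : Finset ι) (G : ι → ℝ → ℝ → ℝ → ℝ)
    (h : ∀ i ∈ s, IsQuadFun (G i)) : IsQuadFun (fun a b c => ∑ i ∈ s, G i a b c) := by
  classical
  induction s using Finset.induction_on with
  | empty => exact ⟨0, 0, 0, 0, 0, 0, 0, 0, 0, 0, by simp⟩
  | insert i s hi ih =>
    obtain ⟨k₀, k₁, k₂, k₃, k₁₁, k₂₂, k₃₃, k₁₂, k₂₃, k₃₁, hk⟩ :=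
      ih fun j hj => h j (Finset.mem_insert_of_mem hj)
    obtain ⟨m₀, m₁, m₂, m₃, m₁₁, m₂₂, m₃₃, m₁₂, m₂₃, m₃₁, hm⟩ := h i (Finset.mem_insert_self i s)
    refine ⟨k₀ + m₀, k₁ + m₁, k₂ + m₂, k₃ + m₃, k₁₁ + m₁₁, k₂₂ + m₂₂, k₃₃ + m₃₃, k₁₂ + m₁₂,
      k₂₃ + m₂₃, k₃₁ + m₃₁, fun a b c => ?_⟩
    beta_reduce at hk ⊢
    rw [Finset.sum_insert hi, hm, hk]
    ring

lemma isQuadFun_mul_affine (r p p₁ p₂ p₃ q q₁ q₂ q₃ : ℝ) :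
    IsQuadFun fun a b c => r * ((p + p₁ * a + p₂ * b + p₃ * c) * (q + q₁ * a + q₂ * b + q₃ * c)) :=
  ⟨r * (p * q), r * (p * q₁ + p₁ * q), r * (p * q₂ + p₂ * q), r * (p * q₃ + p₃ * q),
    r * (p₁ * q₁), r * (p₂ * q₂), r * (p₃ * q₃), r * (p₁ * q₂ + p₂ * q₁),
    r * (p₂ * q₃ + p₃ * q₂), r * (p₃ * q₁ + p₁ * q₃), fun a b c => by ring⟩

lemma isQuadFun_eval (Q : MvPolynomial (Fin 3) ℝ) (hQ : Q.totalDegree ≤ 2) (o u v w : Fin 3 → ℝ) :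
    IsQuadFun fun a b c =>
      MvPolynomial.eval (fun j => o j + u j * a + v j * b + w j * c) Q := by
  simp only [MvPolynomial.eval_eq']
  refine isQuadFun_sum _ _ fun m hm => ?_
  have hdeg := (MvPolynomial.le_totalDegree hm).trans hQ
  rw [Finsupp.sum_fintype _ _ (by simp), Fin.sum_univ_three] at hdeg
  simp only [Fin.prod_univ_three]
  generalize MvPolynomial.coeff m Q = r
  have h1 := isQuadFun_mul_affine r
  generalize m 0 = m0 at *
  generalize m 1 = m1 at *
  generalize m 2 = m2 at *
  have key : ∃ p p₁ p₂ p₃ q q₁ q₂ q₃ : ℝ, ∀ a b c : ℝ,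
      (o 0 + u 0 * a + v 0 * b + w 0 * c) ^ m0 * (o 1 + u 1 * a + v 1 * b + w 1 * c) ^ m1 *
        (o 2 + u 2 * a + v 2 * b + w 2 * c) ^ m2 =
      (p + p₁ * a + p₂ * b + p₃ * c) * (q + q₁ * a + q₂ * b + q₃ * c) := by
    have hm0 : m0 ≤ 2 := by omega
    have hm1 : m1 ≤ 2 := by omega
    have hm2 : m2 ≤ 2 := by omega
    have case2 : ∀ i j : Fin 3, ∃ p p₁ p₂ p₃ q q₁ q₂ q₃ : ℝ, ∀ a b c : ℝ,
        (o i + u i * a + v i * b + w i * c) * (o j + u j * a + v j * b + w j * c) =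
        (p + p₁ * a + p₂ * b + p₃ * c) * (q + q₁ * a + q₂ * b + q₃ * c) := fun i j =>
      ⟨_, _, _, _, _, _, _, _, fun a b c => rfl⟩
    have case1 : ∀ i : Fin 3, ∃ p p₁ p₂ p₃ q q₁ q₂ q₃ : ℝ, ∀ a b c : ℝ,
        (o i + u i * a + v i * b + w i * c) =
        (p + p₁ * a + p₂ * b + p₃ * c) * (q + q₁ * a + q₂ * b + q₃ * c) := fun i =>
      ⟨o i, u i, v i, w i, 1, 0, 0, 0, fun a b c => by ring⟩
    interval_cases m0 <;> interval_cases m1 <;> interval_cases m2 <;>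
    first
    | omega
    | (simp only [pow_zero, pow_one, one_mul, mul_one, sq]
       first
       | exact case2 _ _
       | exact case1 _
       | exact ⟨1, 0, 0, 0, 1, 0, 0, 0, fun a b c => by ring⟩)
  obtain ⟨p, p₁, p₂, p₃, q, q₁, q₂, q₃, hk⟩ := key
  simp only [hk]
  exact h1 ..

/-- A quadric through three edge lines of a cube is the standard one. -/
lemma IsQuadFun.eq_of_three_lines {G : ℝ → ℝ → ℝ → ℝ} (hG : IsQuadFun G)
    (h1 : ∀ t, G t 1 (-1) = 0) (h2 : ∀ t, G (-1) t 1 = 0) (h3 : ∀ t, G 1 (-1) t = 0) :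
    ∃ κ, ∀ a b c, G a b c = κ * (a * b + b * c + c * a + 1) := by
  obtain ⟨k₀, k₁, k₂, k₃, k₁₁, k₂₂, k₃₃, k₁₂, k₂₃, k₃₁, hk⟩ := hG
  have a1 := h1 0
  have a2 := h1 1
  have a3 := h1 (-1)
  have b1 := h2 0
  have b2 := h2 1
  have b3 := h2 (-1)
  have c1 := h3 0
  have c2 := h3 1
  have c3 := h3 (-1)
  rw [hk] at a1 a2 a3 b1 b2 b3 c1 c2 c3
  have e11 : k₁₁ = 0 := by linarith
  have e22 : k₂₂ = 0 := by linarith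
  have e33 : k₃₃ = 0 := by linarith
  subst e11 e22 e33
  have e1 : k₁ = 0 := by linarith
  have e2 : k₂ = 0 := by linarith
  have e3 : k₃ = 0 := by linarith
  have e12 : k₁₂ = k₀ := by linarith
  have e23 : k₂₃ = k₀ := by linarith
  have e31 : k₃₁ = k₀ := by linarith
  subst e1 e2 e3 e12 e23 e31
  exact ⟨k₃₁, fun a b c => by rw [hk]; ring⟩

/-- The quadric conditions on a line in direction `(1, 1, 1)` determine its offset up to sign. -/
lemma sq_sub_eq_of_ruling {hx hy hz U V W : ℝ} (hx0 : hx ≠ 0) (hy0 : hy ≠ 0)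
    (e1 : hx + hy + hz = 0) (e2 : hz * (U + V) + hx * (V + W) + hy * (W + U) = 0)
    (e3 : hz * (U * V) + hx * (V * W) + hy * (W * U) + hx * hy * hz = 0) :
    (U - V) ^ 2 = hz ^ 2 := by
  have h : hx * hy * ((U - V) ^ 2 - hz ^ 2) = 0 := by
    have : hx = -hy - hz := by linarith
    subst this
    have h2 : hz * (U - W) = - hy * (U - V) := by linear_combination e2
    linear_combination (-hz) * e3 + (hz * V - hy * (U - V)) * h2
  have := (mul_eq_zero.1 h).resolve_left (mul_ne_zero hx0 hy0)
  linarith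

/-- Pairwise disjoint lines on a quadric have balanced moments. -/
lemma balanced_of_quadric (hn : ClosedFrame n)
    (hd : ∀ i j : Fin 4, i ≠ j → lineTh (x i) (n i) ∩ lineTh (x j) (n j) = ∅)
    {Q : MvPolynomial (Fin 3) ℝ} (hQ0 : Q ≠ 0) (hQ2 : Q.totalDegree ≤ 2)
    (hQ : ∀ i, ∀ y ∈ lineTh (x i) (n i), MvPolynomial.eval (fun j => y j) Q = 0) :
    MomentBalanced x n := by
  obtain ⟨X, Y, Z, hc⟩ := hn.exists_coords
  obtain ⟨dz, dx, dy, d1, d2, d3⟩ := hc.ne_of_disjoint hd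
  obtain ⟨hx, hhx⟩ : ∃ h, h = (X (x 3) - X (x 2)) / 2 := ⟨_, rfl⟩
  obtain ⟨hy, hhy⟩ : ∃ h, h = (Y (x 1) - Y (x 3)) / 2 := ⟨_, rfl⟩
  obtain ⟨hz, hhz⟩ : ∃ h, h = (Z (x 2) - Z (x 1)) / 2 := ⟨_, rfl⟩
  obtain ⟨mx, hmx⟩ : ∃ m, m = (X (x 2) + X (x 3)) / 2 := ⟨_, rfl⟩
  obtain ⟨my, hmy⟩ : ∃ m, m = (Y (x 1) + Y (x 3)) / 2 := ⟨_, rfl⟩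
  obtain ⟨mz, hmz⟩ : ∃ m, m = (Z (x 1) + Z (x 2)) / 2 := ⟨_, rfl⟩
  have hx0 : hx ≠ 0 := fun h => dx (by linarith)
  have hy0 : hy ≠ 0 := fun h => dy (by linarith)
  have hz0 : hz ≠ 0 := fun h => dz (by linarith)
  obtain ⟨P, PX, PY, PZ, hG⟩ : ∃ P : ℝ → ℝ → ℝ → V3,
      (∀ a b c, X (P a b c) = mx + hx * a) ∧ (∀ a b c, Y (P a b c) = my + hy * b) ∧
      (∀ a b c, Z (P a b c) = mz + hz * c) ∧
      IsQuadFun fun a b c => MvPolynomial.eval (fun j => P a b c j) Q := by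
    refine ⟨fun a b c => (mx + hx * a) • n 1 + (my + hy * b) • n 2 + (mz + hz * c) • n 3,
      fun a b c => by simp [hc.X1, hc.X2, hc.X3], fun a b c => by simp [hc.Y1, hc.Y2, hc.Y3],
      fun a b c => by simp [hc.Z1, hc.Z2, hc.Z3], ?_⟩
    have h := isQuadFun_eval Q hQ2 (fun j => (mx • n 1 + my • n 2 + mz • n 3) j)
      (fun j => hx * n 1 j) (fun j => hy * n 2 j) (fun j => hz * n 3 j)
    have e : ∀ a b c : ℝ, (fun j : Fin 3 => (mx • n 1 + my • n 2 + mz • n 3) j + hx * n 1 j * a +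
        hy * n 2 j * b + hz * n 3 j * c) = fun j =>
        ((mx + hx * a) • n 1 + (my + hy * b) • n 2 + (mz + hz * c) • n 3) j := fun a b c => by
      funext j
      simp only [PiLp.add_apply, PiLp.smul_apply, smul_eq_mul]
      ring
    simpa only [e] using h
  obtain ⟨κ, hκ⟩ := hG.eq_of_three_lines
    (fun t => hQ 1 _ ⟨X (P t 1 (-1)) - X (x 1), hc.ext
      (by simp only [map_add, map_smul, hc.X1, PX, smul_eq_mul]; ring)
      (by simp only [map_add, map_smul, hc.Y1, PY, smul_eq_mul]; linarith)
      (by simp only [map_add, map_smul, hc.Z1, PZ, smul_eq_mul]; linarith)⟩)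
    (fun t => hQ 2 _ ⟨Y (P (-1) t 1) - Y (x 2), hc.ext
      (by simp only [map_add, map_smul, hc.X2, PX, smul_eq_mul]; linarith)
      (by simp only [map_add, map_smul, hc.Y2, PY, smul_eq_mul]; ring)
      (by simp only [map_add, map_smul, hc.Z2, PZ, smul_eq_mul]; linarith)⟩)
    (fun t => hQ 3 _ ⟨Z (P 1 (-1) t) - Z (x 3), hc.ext
      (by simp only [map_add, map_smul, hc.X3, PX, smul_eq_mul]; linarith)
      (by simp only [map_add, map_smul, hc.Y3, PY, smul_eq_mul]; linarith)
      (by simp only [map_add, map_smul, hc.Z3, PZ, smul_eq_mul]; ring)⟩)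
  have hsurj : ∀ y : V3, y = P ((X y - mx) / hx) ((Y y - my) / hy) ((Z y - mz) / hz) := fun y => by
    apply hc.ext
    · rw [PX]; field_simp; ring
    · rw [PY]; field_simp; ring
    · rw [PZ]; field_simp; ring
  have hκ0 : κ ≠ 0 := by
    rintro rfl
    refine hQ0 (MvPolynomial.funext fun y => ?_)
    have h := hκ ((X (WithLp.toLp 2 y) - mx) / hx) ((Y (WithLp.toLp 2 y) - my) / hy)
      ((Z (WithLp.toLp 2 y) - mz) / hz)
    beta_reduce at h
    rw [← hsurj, zero_mul] at h
    rw [map_zero]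
    exact h
  have hL : ∀ t : ℝ, hz * ((X (x 0) - mx - t) * (Y (x 0) - my - t)) +
      hx * ((Y (x 0) - my - t) * (Z (x 0) - mz - t)) +
      hy * ((Z (x 0) - mz - t) * (X (x 0) - mx - t)) + hx * hy * hz = 0 := fun t => by
    have h := hQ 0 (x 0 + t • n 0) ⟨t, rfl⟩
    have h' := hκ ((X (x 0 + t • n 0) - mx) / hx) ((Y (x 0 + t • n 0) - my) / hy)
      ((Z (x 0 + t • n 0) - mz) / hz)
    beta_reduce at h'
    rw [← hsurj, h] at h'
    have h2 := (mul_eq_zero.1 h'.symm).resolve_left hκ0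
    simp only [map_add, map_smul, hc.X0, hc.Y0, hc.Z0, smul_eq_mul] at h2
    field_simp at h2
    linear_combination h2
  have l0 := hL 0
  have l1 := hL 1
  have l2 := hL (-1)
  obtain ⟨U, hU⟩ : ∃ U, U = X (x 0) - mx := ⟨_, rfl⟩
  obtain ⟨V, hV⟩ : ∃ V, V = Y (x 0) - my := ⟨_, rfl⟩
  obtain ⟨W, hW⟩ : ∃ W, W = Z (x 0) - mz := ⟨_, rfl⟩
  rw [← hU, ← hV, ← hW] at l0 l1 l2
  have e1 : hx + hy + hz = 0 := by linarith
  have e2 : hz * (U + V) + hx * (V + W) + hy * (W + U) = 0 := by linarith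
  have e3 : hz * (U * V) + hx * (V * W) + hy * (W * U) + hx * hy * hz = 0 := by linarith
  have r1 : (U - V) ^ 2 = hz ^ 2 := sq_sub_eq_of_ruling hx0 hy0 e1 e2 e3
  have r2 : (V - W) ^ 2 = hx ^ 2 := sq_sub_eq_of_ruling (W := U) hy0 hz0 (by linarith) (by linarith)
    (by linarith)
  have r3 : (W - U) ^ 2 = hy ^ 2 := sq_sub_eq_of_ruling (W := V) hz0 hx0 (by linarith) (by linarith)
    (by linarith)
  have s1 : U - V = hz := (sq_eq_sq_iff_eq_or_eq_neg.1 r1).resolve_right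
    fun h => d3 (by linarith)
  have s2 : V - W = hx := (sq_eq_sq_iff_eq_or_eq_neg.1 r2).resolve_right
    fun h => d1 (by linarith)
  have s3 : W - U = hy := (sq_eq_sq_iff_eq_or_eq_neg.1 r3).resolve_right
    fun h => d2 (by linarith)
  rw [hc.balanced_iff]
  refine ⟨?_, ?_, ?_⟩ <;> linarith

/-- Lines along a closed frame belong generically to one ruling exactly when their moments are
balanced. -/
theorem genOneRuling_iff_momentBalanced (hn : ClosedFrame n) :
    GenOneRuling x n ↔ MomentBalanced x n := by
  constructor
  · rintro (⟨q, hq⟩ | ⟨hd, Q, h0, h2, hQ⟩ | ⟨σ, q₁, q₂, -, h01, h23, h⟩)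
    · exact balanced_of_concurrent hn.sum_eq_zero hq
    · exact balanced_of_quadric hn hd h0 h2 hQ
    · rw [← balanced_comp_perm_iff σ]
      exact balanced_of_planes (hn.comp_perm σ) h01.1 h01.2 h23.1 h23.2 h
  · intro hb
    by_cases hd : ∀ i j : Fin 4, i ≠ j → lineTh (x i) (n i) ∩ lineTh (x j) (n j) = ∅
    · exact Or.inr (Or.inl ⟨hd, exists_quadric_of_balanced hn hb hd⟩)
    · push Not at hd
      obtain ⟨i, j, hij, q₁, hi, hj⟩ := hd
      have hσ : ∀ i j : Fin 4, i ≠ j → ∃ σ : Equiv.Perm (Fin 4), σ 0 = i ∧ σ 1 = j := by decide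
      obtain ⟨σ, rfl, rfl⟩ := hσ i j hij
      rcases concurrent_or_planes_of_balanced (hn.comp_perm σ) (hb.comp_perm σ) hi hj with
        h | ⟨q₂, hne, h2, h3, h⟩
      · refine Or.inl ⟨q₁, fun i => ?_⟩
        simpa using h (σ.symm i)
      · exact Or.inr (Or.inr ⟨σ, q₁, q₂, hne, ⟨hi, hj⟩, ⟨h2, h3⟩, h⟩)

end skew

section tetrahedron

variable {b : AffineBasis (Fin 4) ℝ V3} {m x : Fin 4 → V3}

/-- `m i` is the gradient of the `i`-th barycentric coordinate. -/
def IsGradient (b : AffineBasis (Fin 4) ℝ V3) (m : Fin 4 → V3) : Prop :=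
  ∀ i p q, ⟪m i, p - q⟫_ℝ = b.coord i p - b.coord i q

lemma exists_isGradient (b : AffineBasis (Fin 4) ℝ V3) : ∃ m, IsGradient b m := by
  refine ⟨fun i => (InnerProductSpace.toDual ℝ V3).symm
    (LinearMap.toContinuousLinearMap (b.coord i).linear), fun i p q => ?_⟩
  rw [InnerProductSpace.toDual_symm_apply, LinearMap.coe_toContinuousLinearMap']
  exact (b.coord i).linearMap_vsub p q

lemma IsGradient.coord_add (hm : IsGradient b m) (i : Fin 4) (p w : V3) :
    b.coord i (p + w) = b.coord i p + ⟪m i, w⟫_ℝ := by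
  have := hm i (p + w) p
  rw [add_sub_cancel_left] at this
  linarith

lemma IsGradient.sum_eq_zero (hm : IsGradient b m) : ∑ i, m i = 0 := by
  refine ext_inner_right ℝ fun w => ?_
  have h : ∀ i, ⟪m i, w⟫_ℝ = b.coord i w - b.coord i 0 := fun i => by
    simpa using hm i w 0
  rw [sum_inner, Finset.sum_congr rfl fun i _ => h i, Finset.sum_sub_distrib,
    b.sum_coord_apply_eq_one, b.sum_coord_apply_eq_one]
  simp

lemma IsGradient.eq_sum (hm : IsGradient b m) (w : V3) : w = ∑ i, ⟪m i, w⟫_ℝ • b i := by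
  have h : ∀ i, ⟪m i, w⟫_ℝ = b.coord i w - b.coord i 0 := fun i => by
    simpa using hm i w 0
  simp only [h, sub_smul, Finset.sum_sub_distrib, b.linear_combination_coord_eq_self, sub_zero]

lemma IsGradient.sum_inner_eq_zero (hm : IsGradient b m) (w : V3) : ∑ i, ⟪m i, w⟫_ℝ = 0 := by
  rw [← sum_inner, hm.sum_eq_zero, inner_zero_left]

lemma IsGradient.inner_vertex_sub (hm : IsGradient b m) (i j k : Fin 4) :
    ⟪m i, b j - b k⟫_ℝ = (if i = j then 1 else 0) - if i = k then 1 else 0 := by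
  rw [hm, b.coord_apply, b.coord_apply]

lemma IsGradient.closedFrame (hm : IsGradient b m) : ClosedFrame m where
  sum_eq_zero := hm.sum_eq_zero
  eq_of_relation c hc i j := by
    have h : ⟪∑ k, c k • m k, b i - b j⟫_ℝ = 0 := by rw [hc, inner_zero_left]
    simp only [sum_inner, real_inner_smul_left, hm.inner_vertex_sub, mul_sub,
      Finset.sum_sub_distrib] at h
    simpa [sub_eq_zero] using h

/-- A normal vector to a face is a multiple of the gradient. -/
lemma IsGradient.normal_eq_smul (hm : IsGradient b m) {i : Fin 4} {d p : V3}
    (h : ∀ j, j ≠ i → ⟪d, b j - p⟫_ℝ = 0) : d = ⟪d, b i - p⟫_ℝ • m i := by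
  refine ext_inner_right ℝ fun w => ?_
  have hw : w = ∑ j, ⟪m j, w⟫_ℝ • (b j - p) := by
    simp only [smul_sub, Finset.sum_sub_distrib, ← Finset.sum_smul, hm.sum_inner_eq_zero,
      zero_smul, sub_zero]
    exact hm.eq_sum w
  conv_lhs => rw [hw]
  rw [inner_sum, Finset.sum_eq_single i (fun j _ hj => by rw [real_inner_smul_right, h j hj,
    mul_zero]) (by simp), real_inner_smul_right, real_inner_smul_left]
  ring

lemma lineTh_smul (p d : V3) {c : ℝ} (hc : c ≠ 0) : lineTh p (c • d) = lineTh p d := by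
  ext q
  constructor
  · rintro ⟨t, rfl⟩
    exact ⟨t * c, by rw [mul_smul]⟩
  · rintro ⟨t, rfl⟩
    exact ⟨t / c, by rw [smul_smul, div_mul_cancel₀ _ hc]⟩

/-- The point `x i` lies in the relative interior of the `i`-th face. -/
def OnFaces (b : AffineBasis (Fin 4) ℝ V3) (x : Fin 4 → V3) : Prop :=
  ∀ i, b.coord i (x i) = 0 ∧ ∀ j, j ≠ i → 0 < b.coord j (x i)

lemma coord_of_mem_intrinsicInterior {i : Fin 4} {p : V3}
    (hp : p ∈ intrinsicInterior ℝ (convexHull ℝ (b '' {i}ᶜ))) :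
    b.coord i p = 0 ∧ ∀ j, j ≠ i → 0 < b.coord j p := by
  have h0 : convexHull ℝ (b '' {i}ᶜ) ⊆ b.coord i ⁻¹' {0} := by
    refine convexHull_min ?_ ((convex_singleton (0 : ℝ)).affine_preimage _)
    rintro _ ⟨j, hj, rfl⟩
    exact b.coord_apply_ne (Ne.symm hj)
  have hpos : ∀ q ∈ convexHull ℝ (b '' {i}ᶜ), ∀ j, 0 ≤ b.coord j q := fun q hq => by
    have := convexHull_mono (Set.image_subset_range b {i}ᶜ) hq
    rwa [b.convexHull_eq_nonneg_coord] at this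
  refine ⟨h0 (intrinsicInterior_subset hp), fun j hj => ?_⟩
  obtain ⟨y, hy, rfl⟩ := hp
  have hmem : b j ∈ affineSpan ℝ (convexHull ℝ (b '' {i}ᶜ)) :=
    subset_affineSpan ℝ _ (subset_convexHull ℝ _ ⟨j, hj, rfl⟩)
  let f : ℝ → affineSpan ℝ (convexHull ℝ (b '' {i}ᶜ)) := fun t =>
    ⟨AffineMap.lineMap (b j) (y : V3) t, AffineMap.lineMap_mem t hmem y.2⟩
  have hf : Continuous f := AffineMap.lineMap_continuous.subtype_mk _
  have hf1 : f 1 = y := by simp [f]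
  have hev := hf.continuousAt.preimage_mem_nhds (x := 1)
    (by rw [hf1]; exact mem_interior_iff_mem_nhds.1 hy)
  obtain ⟨ε, hε, hball⟩ := Metric.mem_nhds_iff.1 hev
  have h := hpos _ (hball (show (1 + ε / 2) ∈ Metric.ball (1 : ℝ) ε by
    rw [Metric.mem_ball, Real.dist_eq, add_sub_cancel_left, abs_of_pos (by linarith)]
    linarith)) j
  simp only [f] at h
  rw [AffineMap.apply_lineMap, b.coord_apply_eq, AffineMap.lineMap_apply_ring] at h
  nlinarith

lemma mem_interior_image_iff (b : AffineBasis (Fin 4) ℝ V3) (ρ : V3 ≃ₗᵢ[ℝ] V3) (v p : V3) :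
    p ∈ interior ((fun q => ρ q + v) '' convexHull ℝ (Set.range b)) ↔
      ∀ i, 0 < b.coord i (ρ.symm (p - v)) := by
  let h : V3 ≃ₜ V3 := ρ.toHomeomorph.trans (Homeomorph.addRight v)
  have e : ((fun q => ρ q + v) '' convexHull ℝ (Set.range b)) =
      h '' convexHull ℝ (Set.range b) := rfl
  rw [e, ← h.image_interior, b.interior_convexHull, h.image_eq_preimage_symm]
  have e2 : h.symm p = ρ.symm (p - v) := by
    rw [Homeomorph.symm_apply_eq]
    simp [h]
  rw [Set.mem_preimage, e2, Set.mem_ofPred_eq]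

/-- The linear map whose antisymmetric part is the total moment. -/
def momentMap (x m : Fin 4 → V3) : V3 →ₗ[ℝ] V3 := ∑ i, (innerₛₗ ℝ (m i)).smulRight (x i)

lemma momentMap_apply (x m : Fin 4 → V3) (w : V3) : momentMap x m w = ∑ i, ⟪m i, w⟫_ℝ • x i := by
  simp [momentMap]

lemma MomentBalanced.isSymmetric (h : MomentBalanced x m) : (momentMap x m).IsSymmetric := by
  intro p q
  have := h (innerₛₗ ℝ p) (innerₛₗ ℝ q)
  simp only [innerₛₗ_apply_apply, Finset.sum_sub_distrib, sub_eq_zero] at this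
  simp only [momentMap_apply, sum_inner, inner_sum, real_inner_smul_left, real_inner_smul_right]
  rw [Finset.sum_congr rfl fun i _ => mul_comm ⟪m i, q⟫_ℝ _,
    Finset.sum_congr rfl fun i _ => mul_comm ⟪m i, p⟫_ℝ _]
  simp only [real_inner_comm p, real_inner_comm q] at this ⊢
  exact this.symm

lemma inner_sub_eq_sum (b : AffineBasis (Fin 4) ℝ V3) (u p : V3) (c : ℝ) :
    ⟪u, p⟫_ℝ - c = ∑ j, b.coord j p * (⟪u, b j⟫_ℝ - c) := by
  conv_lhs => rw [← b.linear_combination_coord_eq_self p]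
  simp only [mul_sub, Finset.sum_sub_distrib, inner_sum, real_inner_smul_right, ← Finset.sum_mul,
    b.sum_coord_apply_eq_one, one_mul]

/-- The eigenvalues of a symmetric moment map exceed `-1`. -/
lemma neg_one_lt_of_eigenvector (hm : IsGradient b m) (hx : OnFaces b x)
    (hA : (momentMap x m).IsSymmetric) {u : V3} {μ : ℝ} (hu : u ≠ 0)
    (h : momentMap x m u = μ • u) : -1 < μ := by
  have key : ∀ i k, ⟪u, x i⟫_ℝ - ⟪u, x k⟫_ℝ = μ * (⟪u, b i⟫_ℝ - ⟪u, b k⟫_ℝ) := fun i k => by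
    have h1 := hA u (b i - b k)
    rw [h, real_inner_smul_left, momentMap_apply, inner_sub_right] at h1
    rw [h1]
    simp [hm.inner_vertex_sub, sub_smul, Finset.sum_sub_distrib, inner_sub_right]
  obtain ⟨i, -, hi⟩ := Finset.exists_max_image Finset.univ (fun i => ⟪u, b i⟫_ℝ) ⟨0, by simp⟩
  obtain ⟨k, -, hk⟩ := Finset.exists_min_image Finset.univ (fun i => ⟪u, b i⟫_ℝ) ⟨0, by simp⟩
  replace hi := fun j => hi j (Finset.mem_univ j)
  replace hk := fun j => hk j (Finset.mem_univ j)
  have hw : ∀ i j, 0 ≤ b.coord j (x i) := fun i j => by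
    rcases eq_or_ne j i with rfl | hj
    · exact (hx j).1.ge
    · exact ((hx i).2 j hj).le
  have hlt : ⟪u, b k⟫_ℝ < ⟪u, b i⟫_ℝ := by
    refine lt_of_not_ge fun hle => hu ?_
    have hc : ∀ j, ⟪u, b j⟫_ℝ = ⟪u, b k⟫_ℝ := fun j =>
      le_antisymm ((hi j).trans hle) (hk j)
    rw [← inner_self_eq_zero (𝕜 := ℝ)]
    refine (congrArg (fun w => ⟪u, w⟫_ℝ) (hm.eq_sum u)).trans ?_
    simp only [inner_sum, real_inner_smul_right, hc, ← Finset.sum_mul, hm.sum_inner_eq_zero,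
      zero_mul]
  have hik : i ≠ k := by rintro rfl; exact lt_irrefl _ hlt
  have hex : ∀ i k : Fin 4, i ≠ k → ∃ j, j ≠ i ∧ j ≠ k := by decide
  obtain ⟨j, hji, hjk⟩ := hex i k hik
  have g1 : 0 ≤ ⟪u, x i⟫_ℝ - ⟪u, b k⟫_ℝ := by
    rw [inner_sub_eq_sum b]
    exact Finset.sum_nonneg fun l _ => mul_nonneg (hw i l) (sub_nonneg.2 (hk l))
  have g2 : ⟪u, x k⟫_ℝ - ⟪u, b i⟫_ℝ ≤ 0 := by
    rw [inner_sub_eq_sum b]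
    exact Finset.sum_nonpos fun l _ => mul_nonpos_of_nonneg_of_nonpos (hw k l)
      (sub_nonpos.2 (hi l))
  have g : ⟪u, x k⟫_ℝ - ⟪u, x i⟫_ℝ < ⟪u, b i⟫_ℝ - ⟪u, b k⟫_ℝ := by
    rcases lt_or_ge ⟪u, b k⟫_ℝ ⟪u, b j⟫_ℝ with hj | hj
    · have : 0 < ⟪u, x i⟫_ℝ - ⟪u, b k⟫_ℝ := by
        rw [inner_sub_eq_sum b]
        exact Finset.sum_pos' (fun l _ => mul_nonneg (hw i l) (sub_nonneg.2 (hk l)))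
          ⟨j, Finset.mem_univ j, mul_pos ((hx i).2 j hji) (sub_pos.2 hj)⟩
      linarith
    · have : ⟪u, x k⟫_ℝ - ⟪u, b i⟫_ℝ < 0 := by
        rw [inner_sub_eq_sum b]
        exact Finset.sum_neg' (fun l _ => mul_nonpos_of_nonneg_of_nonpos (hw k l)
          (sub_nonpos.2 (hi l)))
          ⟨j, Finset.mem_univ j, mul_neg_of_pos_of_neg ((hx k).2 j hjk) (by linarith)⟩
      linarith
  have := key k i
  nlinarith

lemma sum_inner_map_eq {ι : Type*} [Fintype ι] (u : OrthonormalBasis ι ℝ V3) (x m : Fin 4 → V3)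
    (M : V3 →ₗ[ℝ] V3) : ∑ i, ⟪m i, M (x i)⟫_ℝ = ∑ k, ⟪momentMap x m (M (u k)), u k⟫_ℝ := by
  have h : ∀ i, ⟪m i, M (x i)⟫_ℝ = ∑ k, ⟪m i, M (u k)⟫_ℝ * ⟪x i, u k⟫_ℝ := fun i => by
    conv_lhs => rw [← u.sum_repr' (x i)]
    simp only [map_sum, map_smul, inner_sum, real_inner_smul_right]
    exact Finset.sum_congr rfl fun k _ => by rw [mul_comm, real_inner_comm (x i) (u k)]
  simp only [h, momentMap_apply, sum_inner, real_inner_smul_left]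
  exact Finset.sum_comm

/-- Diagonal entries of a rotation matrix. -/
lemma rotation_diag {R : Matrix (Fin 3) (Fin 3) ℝ} (h1 : R * R.transpose = 1) (hdet : R.det = 1) :
    R = 1 ∨ (0 ≤ 1 + R 0 0 - R 1 1 - R 2 2 ∧ 0 ≤ 1 + R 1 1 - R 2 2 - R 0 0 ∧
      0 ≤ 1 + R 2 2 - R 0 0 - R 1 1 ∧ 0 < 3 - R 0 0 - R 1 1 - R 2 2) := by
  have h2 : R.transpose * R = 1 := mul_eq_one_comm.1 h1
  have h3 : R.adjugate = R.transpose := by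
    have := congrArg (R.adjugate * ·) h1
    simpa [← Matrix.mul_assoc, Matrix.adjugate_mul, hdet] using this.symm
  have r := fun i => congrFun (congrFun h1 i) i
  have c := fun i => congrFun (congrFun h2 i) i
  have a := fun i => congrFun (congrFun h3 i) i
  have r0 := r 0
  have r1 := r 1
  have r2 := r 2
  have c0 := c 0
  have c1 := c 1
  have c2 := c 2
  have a0 := a 0
  have a1 := a 1
  have a2 := a 2
  clear r c a
  simp [Matrix.mul_apply, Fin.sum_univ_three] at r0 r1 r2 c0 c1 c2
  simp [Matrix.adjugate_fin_three] at a0 a1 a2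
  have k01 : (1 + R 0 0 - R 1 1 - R 2 2) * (1 + R 1 1 - R 2 2 - R 0 0) = (R 0 1 + R 1 0) ^ 2 := by
    linear_combination 2 * a2 - r0 - r1 + c2
  have k12 : (1 + R 1 1 - R 2 2 - R 0 0) * (1 + R 2 2 - R 0 0 - R 1 1) = (R 1 2 + R 2 1) ^ 2 := by
    linear_combination 2 * a0 - r1 - r2 + c0
  have k20 : (1 + R 2 2 - R 0 0 - R 1 1) * (1 + R 0 0 - R 1 1 - R 2 2) = (R 2 0 + R 0 2) ^ 2 := by
    linear_combination 2 * a1 - r2 - r0 + c1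
  rcases le_or_gt (3 - R 0 0 - R 1 1 - R 2 2) 0 with h | h
  · left
    have hle : ∀ p q r : ℝ, p * p + q * q + r * r = 1 → p ≤ 1 := fun p q r h => by
      nlinarith [mul_self_nonneg q, mul_self_nonneg r]
    have hz : ∀ p q : ℝ, p * p + q * q = 0 → p = 0 ∧ q = 0 := fun p q h => by
      rw [← mul_self_eq_zero, ← mul_self_eq_zero (a := q)]
      exact ⟨by linarith [mul_self_nonneg p, mul_self_nonneg q],
        by linarith [mul_self_nonneg p, mul_self_nonneg q]⟩
    have d0 := hle _ _ _ r0
    have d1 := hle (R 1 1) (R 1 0) (R 1 2) (by linarith)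
    have d2 := hle (R 2 2) (R 2 0) (R 2 1) (by linarith)
    have e0 : R 0 0 = 1 := by linarith
    have e1 : R 1 1 = 1 := by linarith
    have e2 : R 2 2 = 1 := by linarith
    rw [e0] at r0
    rw [e1] at r1
    rw [e2] at r2
    obtain ⟨f01, f02⟩ := hz (R 0 1) (R 0 2) (by linarith)
    obtain ⟨f10, f12⟩ := hz (R 1 0) (R 1 2) (by linarith)
    obtain ⟨f20, f21⟩ := hz (R 2 0) (R 2 1) (by linarith)
    ext i j
    fin_cases i <;> fin_cases j <;> simp [*]
  · right
    refine ⟨?_, ?_, ?_, h⟩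
    · refine nonneg_of_mul_nonneg_left (b := 3 - R 0 0 - R 1 1 - R 2 2) ?_ h
      linarith [sq_nonneg (1 + R 0 0 - R 1 1 - R 2 2), sq_nonneg (R 0 1 + R 1 0),
        sq_nonneg (R 2 0 + R 0 2)]
    · refine nonneg_of_mul_nonneg_left (b := 3 - R 0 0 - R 1 1 - R 2 2) ?_ h
      linarith [sq_nonneg (1 + R 1 1 - R 2 2 - R 0 0), sq_nonneg (R 0 1 + R 1 0),
        sq_nonneg (R 1 2 + R 2 1)]
    · refine nonneg_of_mul_nonneg_left (b := 3 - R 0 0 - R 1 1 - R 2 2) ?_ h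
      linarith [sq_nonneg (1 + R 2 2 - R 0 0 - R 1 1), sq_nonneg (R 1 2 + R 2 1),
        sq_nonneg (R 2 0 + R 0 2)]

lemma linearIsometryEquiv_eq_or_diag (u : OrthonormalBasis (Fin 3) ℝ V3) (R : V3 ≃ₗᵢ[ℝ] V3)
    (hdet : 0 < LinearMap.det (R.toLinearEquiv : V3 →ₗ[ℝ] V3)) {r : Fin 3 → ℝ}
    (hr : ∀ k, r k = ⟪u k, R (u k)⟫_ℝ) :
    (∀ w, R w = w) ∨ (0 ≤ 1 + r 0 - r 1 - r 2 ∧ 0 ≤ 1 + r 1 - r 2 - r 0 ∧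
      0 ≤ 1 + r 2 - r 0 - r 1 ∧ 0 < 3 - r 0 - r 1 - r 2) := by
  obtain ⟨M, hM⟩ : ∃ M : Matrix (Fin 3) (Fin 3) ℝ,
    M = LinearMap.toMatrix u.toBasis u.toBasis (R.toLinearEquiv : V3 →ₗ[ℝ] V3) := ⟨_, rfl⟩
  have hMe : ∀ i j, M i j = ⟪u i, R (u j)⟫_ℝ := fun i j => by
    rw [hM, LinearMap.toMatrix_apply]
    simp [u.repr_apply_apply]
  have h1 : M.transpose * M = 1 := by
    ext i j
    rw [Matrix.mul_apply]
    simp only [Matrix.transpose_apply, hMe]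
    rw [Finset.sum_congr rfl fun k _ => by rw [real_inner_comm], u.sum_inner_mul_inner,
      R.inner_map_map, orthonormal_iff_ite.1 u.orthonormal, Matrix.one_apply]
  have hd : M.det = 1 := by
    have h2 := congrArg Matrix.det h1
    rw [Matrix.det_mul, Matrix.det_transpose, Matrix.det_one] at h2
    have h3 : 0 < M.det := by rwa [hM, LinearMap.det_toMatrix]
    nlinarith
  rcases rotation_diag (mul_eq_one_comm.1 h1) hd with h | h
  · left
    have h4 : (R.toLinearEquiv : V3 →ₗ[ℝ] V3) = LinearMap.id := by
      apply (LinearMap.toMatrix u.toBasis u.toBasis).injective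
      rw [← hM, h, LinearMap.toMatrix_id]
    exact fun w => LinearMap.congr_fun h4 w
  · right
    simpa only [hMe, ← hr] using h

/-- With a symmetric moment map, a nontrivial rotation moves the points inwards on average. -/
lemma sum_inner_rotation_pos (hm : IsGradient b m) (hx : OnFaces b x)
    (hA : (momentMap x m).IsSymmetric) (R : V3 ≃ₗᵢ[ℝ] V3)
    (hdet : 0 < LinearMap.det (R.toLinearEquiv : V3 →ₗ[ℝ] V3)) :
    (∀ w, R w = w) ∨ 0 < ∑ i, ⟪m i, R (x i) - x i⟫_ℝ := by
  have hfr : Module.finrank ℝ V3 = 3 := by simp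
  obtain ⟨u, hu⟩ : ∃ u, u = hA.eigenvectorBasis hfr := ⟨_, rfl⟩
  obtain ⟨μ, hμ⟩ : ∃ μ, μ = hA.eigenvalues hfr := ⟨_, rfl⟩
  have hAu : ∀ k, momentMap x m (u k) = μ k • u k := fun k => by
    rw [hu, hμ]
    exact hA.apply_eigenvectorBasis hfr k
  have hpos : ∀ k, -1 < μ k := fun k =>
    neg_one_lt_of_eigenvector hm hx hA (u.orthonormal.ne_zero k) (hAu k)
  have hone : ∀ k, ⟪u k, u k⟫_ℝ = 1 := fun k => by simp
  obtain ⟨r, hr⟩ : ∃ r : Fin 3 → ℝ, ∀ k, r k = ⟪u k, R (u k)⟫_ℝ := ⟨_, fun _ => rfl⟩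
  have htr : ∑ k, μ k = -1 := by
    have h := sum_inner_map_eq u x m LinearMap.id
    have h2 : ∑ i, ⟪m i, x i⟫_ℝ = -1 := by
      have h3 : ∀ i, ⟪m i, x i⟫_ℝ = - b.coord i 0 := fun i => by
        have := hm i (x i) 0
        rw [(hx i).1] at this
        simpa using this
      rw [Finset.sum_congr rfl fun i _ => h3 i, Finset.sum_neg_distrib, b.sum_coord_apply_eq_one]
    simp only [LinearMap.id_apply, hAu, real_inner_smul_left, hone, mul_one] at h
    rw [← h, h2]
  have hsum : ∑ i, ⟪m i, R (x i) - x i⟫_ℝ = ∑ k, μ k * (r k - 1) := by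
    have h := sum_inner_map_eq u x m ((R.toLinearEquiv : V3 →ₗ[ℝ] V3) - LinearMap.id)
    refine h.trans (Finset.sum_congr rfl fun k _ => ?_)
    rw [hA, hAu, real_inner_smul_right, real_inner_comm, hr]
    simp [inner_sub_right]
  rcases linearIsometryEquiv_eq_or_diag u R hdet hr with h | ⟨h0, h1, h2, h⟩
  · exact Or.inl h
  · right
    rw [hsum]
    rw [Fin.sum_univ_three] at htr ⊢
    have p0 := hpos 0
    have p1 := hpos 1
    have p2 := hpos 2
    have k0 := mul_nonneg (show 0 ≤ μ 0 + 1 by linarith) h0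
    have k1 := mul_nonneg (show 0 ≤ μ 1 + 1 by linarith) h1
    have k2 := mul_nonneg (show 0 ≤ μ 2 + 1 by linarith) h2
    have e : μ 0 * (r 0 - 1) + μ 1 * (r 1 - 1) + μ 2 * (r 2 - 1) =
        ((μ 0 + 1) * (1 + r 0 - r 1 - r 2) + (μ 1 + 1) * (1 + r 1 - r 2 - r 0) +
        (μ 2 + 1) * (1 + r 2 - r 0 - r 1)) / 2 := by
      have : μ 2 = -1 - μ 0 - μ 1 := by linarith
      rw [this]
      ring
    rw [e]
    refine lt_of_le_of_ne (by linarith) fun h3 => ?_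
    have z0 : (μ 0 + 1) * (1 + r 0 - r 1 - r 2) = 0 := by linarith
    have z1 : (μ 1 + 1) * (1 + r 1 - r 2 - r 0) = 0 := by linarith
    have z2 : (μ 2 + 1) * (1 + r 2 - r 0 - r 1) = 0 := by linarith
    have y0 := (mul_eq_zero.1 z0).resolve_left (by linarith)
    have y1 := (mul_eq_zero.1 z1).resolve_left (by linarith)
    have y2 := (mul_eq_zero.1 z2).resolve_left (by linarith)
    linarith

lemma immobilizes_of_balanced (hm : IsGradient b m) (hx : OnFaces b x) (h : MomentBalanced x m) :
    Immobilizes3 {x 0, x 1, x 2, x 3} (convexHull ℝ (Set.range b)) := by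
  have hopen : ∀ i, ∃ δ > 0, ∀ y, dist y (x i) < δ → ∀ j, j ≠ i → 0 < b.coord j y := fun i => by
    have hev : ∀ᶠ y in nhds (x i), ∀ j, j ≠ i → 0 < b.coord j y := by
      refine Filter.eventually_all.2 fun j => ?_
      by_cases hj : j = i
      · simp [hj]
      · filter_upwards [((b.coord j).continuous_of_finiteDimensional.tendsto (x i)).eventually
          (lt_mem_nhds ((hx i).2 j hj))] with y hy _ using hy
    exact Metric.eventually_nhds_iff.1 hev
  choose δ hδ hδx using hopen
  obtain ⟨ε, hε, hεδ⟩ : ∃ ε > 0, ∀ i, ε * ‖x i‖ + ε < δ i := by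
    have hev : ∀ᶠ ε in nhdsWithin (0 : ℝ) (Set.Ioi 0), 0 < ε ∧ ∀ i, ε * ‖x i‖ + ε < δ i := by
      refine Filter.Eventually.and self_mem_nhdsWithin (Filter.eventually_all.2 fun i => ?_)
      have hc : Continuous fun ε : ℝ => ε * ‖x i‖ + ε := by fun_prop
      have := (hc.tendsto 0).eventually (gt_mem_nhds (show 0 * ‖x i‖ + 0 < δ i by simpa using hδ i))
      exact this.filter_mono nhdsWithin_le_nhds
    obtain ⟨ε, h1, h2⟩ := hev.exists
    exact ⟨ε, h1, h2⟩
  refine ⟨ε, hε, fun ρ v hdet hρ hv hne => ?_⟩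
  by_contra! hcon
  have hmem : ∀ i, x i ∈ ({x 0, x 1, x 2, x 3} : Set V3) := fun i => by
    fin_cases i <;> simp
  have hle : ∀ i, b.coord i (ρ.symm (x i - v)) ≤ 0 := fun i => by
    have h1 := hcon (x i) (hmem i)
    rw [mem_interior_image_iff] at h1
    by_contra! h2
    refine h1 fun j => ?_
    rcases eq_or_ne j i with rfl | hj
    · exact h2
    · refine hδx i _ ?_ j hj
      have h3 : dist (ρ.symm (x i - v)) (x i) = ‖ρ (x i) - x i + v‖ := by
        rw [dist_comm, ← ρ.dist_map, ρ.apply_symm_apply, dist_eq_norm]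
        congr 1
        abel
      rw [h3]
      exact (norm_add_le _ _).trans_lt ((add_lt_add_of_le_of_lt (hρ _) hv).trans (hεδ i))
  have hterm : ∀ i, ⟪m i, ρ.symm (x i) - x i⟫_ℝ - ⟪m i, ρ.symm v⟫_ℝ ≤ 0 := fun i => by
    have h1 := hm i (ρ.symm (x i - v)) (x i)
    rw [(hx i).1, map_sub, sub_right_comm, inner_sub_right] at h1
    have h2 := hle i
    rw [map_sub] at h2
    linarith
  have hsum : ∑ i, (⟪m i, ρ.symm (x i) - x i⟫_ℝ - ⟪m i, ρ.symm v⟫_ℝ) =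
      ∑ i, ⟪m i, ρ.symm (x i) - x i⟫_ℝ := by
    rw [Finset.sum_sub_distrib, hm.sum_inner_eq_zero, sub_zero]
  have hdet' : 0 < LinearMap.det (ρ.symm.toLinearEquiv : V3 →ₗ[ℝ] V3) := by
    have h1 : LinearMap.det (ρ.symm.toLinearEquiv : V3 →ₗ[ℝ] V3) *
        LinearMap.det (ρ.toLinearEquiv : V3 →ₗ[ℝ] V3) = 1 :=
      LinearEquiv.det_symm_mul_det ρ.toLinearEquiv
    exact pos_of_mul_pos_left (by rw [h1]; exact one_pos) hdet.le
  rcases sum_inner_rotation_pos hm hx h.isSymmetric ρ.symm hdet' with hR | hR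
  · have hz : ∀ i, ⟪m i, v⟫_ℝ = 0 := by
      simp only [hR, sub_self, inner_zero_right, zero_sub] at hterm
      have h1 := (Finset.sum_eq_zero_iff_of_nonneg fun i _ => neg_nonpos.1 (hterm i)).1
        (hm.sum_inner_eq_zero v)
      exact fun i => h1 i (Finset.mem_univ i)
    have hv0 : v = 0 := by
      rw [hm.eq_sum v]
      simp [hz]
    obtain ⟨q, hq⟩ := hne
    apply hq
    rw [hv0, add_zero]
    conv_lhs => rw [← hR q, ρ.apply_symm_apply]
  · have := Finset.sum_nonpos fun i (_ : i ∈ Finset.univ) => hterm i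
    linarith

/-- The rotation by `θ` in the plane of the orthonormal vectors `p`, `q`. -/
def planeRot (p q : V3) (θ : ℝ) : V3 →ₗ[ℝ] V3 :=
  LinearMap.id + sin θ • ((innerₛₗ ℝ p).smulRight q - (innerₛₗ ℝ q).smulRight p) -
    (1 - cos θ) • ((innerₛₗ ℝ p).smulRight p + (innerₛₗ ℝ q).smulRight q)

lemma planeRot_apply (p q : V3) (θ : ℝ) (y : V3) : planeRot p q θ y =
    y + sin θ • (⟪p, y⟫_ℝ • q - ⟪q, y⟫_ℝ • p) -
      (1 - cos θ) • (⟪p, y⟫_ℝ • p + ⟪q, y⟫_ℝ • q) := by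
  simp [planeRot]

lemma planeRot_planeRot {p q : V3} (hp : ‖p‖ = 1) (hq : ‖q‖ = 1) (hpq : ⟪p, q⟫_ℝ = 0)
    (θ τ : ℝ) (y : V3) :
    planeRot p q θ (planeRot p q τ y) = planeRot p q (θ + τ) y := by
  have hqp : ⟪q, p⟫_ℝ = 0 := by rw [real_inner_comm, hpq]
  have hp1 : ⟪p, p⟫_ℝ = 1 := by rw [real_inner_self_eq_norm_sq, hp, one_pow]
  have hq1 : ⟪q, q⟫_ℝ = 1 := by rw [real_inner_self_eq_norm_sq, hq, one_pow]
  simp only [planeRot_apply, inner_add_right, inner_sub_right, real_inner_smul_right, hp1, hq1,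
    hpq, hqp, sin_add, cos_add]
  module

lemma norm_planeRot {p q : V3} (hp : ‖p‖ = 1) (hq : ‖q‖ = 1) (hpq : ⟪p, q⟫_ℝ = 0)
    (θ : ℝ) (y : V3) : ‖planeRot p q θ y‖ = ‖y‖ := by
  have hqp : ⟪q, p⟫_ℝ = 0 := by rw [real_inner_comm, hpq]
  have hp1 : ⟪p, p⟫_ℝ = 1 := by rw [real_inner_self_eq_norm_sq, hp, one_pow]
  have hq1 : ⟪q, q⟫_ℝ = 1 := by rw [real_inner_self_eq_norm_sq, hq, one_pow]
  rw [← sq_eq_sq₀ (norm_nonneg _) (norm_nonneg _), ← real_inner_self_eq_norm_sq,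
    ← real_inner_self_eq_norm_sq, planeRot_apply]
  simp only [inner_add_right, inner_sub_right, real_inner_smul_right, inner_add_left,
    inner_sub_left, real_inner_smul_left, hp1, hq1, hpq, hqp, real_inner_comm p y,
    real_inner_comm q y]
  linear_combination (⟪p, y⟫_ℝ ^ 2 + ⟪q, y⟫_ℝ ^ 2) * sin_sq_add_cos_sq θ

lemma exists_planeRot_equiv {p q : V3} (hp : ‖p‖ = 1) (hq : ‖q‖ = 1) (hpq : ⟪p, q⟫_ℝ = 0)
    (θ : ℝ) :
    ∃ ρ : V3 ≃ₗᵢ[ℝ] V3, 0 < LinearMap.det (ρ.toLinearEquiv : V3 →ₗ[ℝ] V3) ∧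
      (∀ y, ρ y = planeRot p q (-θ) y) ∧
      ∀ y, ρ.symm y = planeRot p q θ y := by
  have h0 : ∀ y, planeRot p q 0 y = y := fun y => by simp [planeRot_apply]
  have h1 : ∀ τ, planeRot p q τ ∘ₗ planeRot p q (-τ) = LinearMap.id := fun τ =>
    LinearMap.ext fun y => by
      rw [LinearMap.comp_apply, planeRot_planeRot hp hq hpq, add_neg_cancel, h0, LinearMap.id_apply]
  have h2 : ∀ τ, planeRot p q (-τ) ∘ₗ planeRot p q τ = LinearMap.id := fun τ => by
    simpa using h1 (-τ)
  refine ⟨⟨LinearEquiv.ofLinearMap (planeRot p q (-θ)) (planeRot p q θ) (h2 θ) (h1 θ),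
    fun y => norm_planeRot hp hq hpq _ y⟩, ?_, fun y => rfl, fun y => rfl⟩
  have h3 : planeRot p q (-θ) = planeRot p q (-(θ / 2)) ∘ₗ planeRot p q (-(θ / 2)) :=
    LinearMap.ext fun y => by
      rw [LinearMap.comp_apply, planeRot_planeRot hp hq hpq]
      congr 2
      ring
  have h4 : LinearMap.det (planeRot p q (-(θ / 2))) ≠ 0 := fun h => by
    have := congrArg LinearMap.det (h1 (θ / 2))
    rw [LinearMap.det_comp, h, mul_zero, LinearMap.det_id] at this
    exact zero_ne_one this
  change 0 < LinearMap.det (planeRot p q (-θ))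
  rw [h3, LinearMap.det_comp]
  exact mul_self_pos.2 h4

lemma norm_planeRot_sub_le {p q : V3} (hp : ‖p‖ = 1) (hq : ‖q‖ = 1) (θ : ℝ) (y : V3) :
    ‖planeRot p q θ y - y‖ ≤ (2 * |sin θ| + 2 * |1 - cos θ|) * ‖y‖ := by
  have h1 : |⟪p, y⟫_ℝ| ≤ ‖y‖ := by simpa [hp] using abs_real_inner_le_norm p y
  have h2 : |⟪q, y⟫_ℝ| ≤ ‖y‖ := by simpa [hq] using abs_real_inner_le_norm q y
  have e : planeRot p q θ y - y = sin θ • (⟪p, y⟫_ℝ • q - ⟪q, y⟫_ℝ • p) -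
      (1 - cos θ) • (⟪p, y⟫_ℝ • p + ⟪q, y⟫_ℝ • q) := by
    rw [planeRot_apply]
    abel
  have h3 : ‖⟪p, y⟫_ℝ • q - ⟪q, y⟫_ℝ • p‖ ≤ 2 * ‖y‖ := by
    refine (norm_sub_le _ _).trans ?_
    rw [norm_smul, norm_smul, hp, hq, Real.norm_eq_abs, Real.norm_eq_abs]
    linarith
  have h4 : ‖⟪p, y⟫_ℝ • p + ⟪q, y⟫_ℝ • q‖ ≤ 2 * ‖y‖ := by
    refine (norm_add_le _ _).trans ?_
    rw [norm_smul, norm_smul, hp, hq, Real.norm_eq_abs, Real.norm_eq_abs]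
    linarith
  rw [e]
  refine (norm_sub_le _ _).trans ?_
  rw [norm_smul, norm_smul, Real.norm_eq_abs, Real.norm_eq_abs]
  have h5 := mul_le_mul_of_nonneg_left h3 (abs_nonneg (sin θ))
  have h6 := mul_le_mul_of_nonneg_left h4 (abs_nonneg (1 - cos θ))
  linarith

lemma exists_orthonormal_pair (h : ¬ MomentBalanced x m) : ∃ p q : V3, ‖p‖ = 1 ∧ ‖q‖ = 1 ∧
    ⟪p, q⟫_ℝ = 0 ∧ ∑ i, ⟪m i, ⟪p, x i⟫_ℝ • q - ⟪q, x i⟫_ℝ • p⟫_ℝ < 0 := by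
  have key : ∃ k l : Fin 3, ∑ i, (x i k * m i l - x i l * m i k) < 0 := by
    by_contra! hge
    have h0 : ∀ k l, ∑ i, (x i k * m i l - x i l * m i k) = 0 := fun k l => by
      refine le_antisymm ?_ (hge k l)
      have h1 := hge l k
      have h2 : ∑ i, (x i l * m i k - x i k * m i l) = -∑ i, (x i k * m i l - x i l * m i k) := by
        rw [← Finset.sum_neg_distrib]
        exact Finset.sum_congr rfl fun i _ => by ring
      linarith
    refine h fun f g => ?_
    obtain ⟨c, hc⟩ := exists_eq_sum_coords f
    obtain ⟨c', hc'⟩ := exists_eq_sum_coords g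
    have e : ∑ i, (f (x i) * g (m i) - g (x i) * f (m i)) =
        ∑ k, ∑ l, c k * c' l * ∑ i, (x i k * m i l - x i l * m i k) := by
      simp only [hc, hc', Fin.sum_univ_three, Fin.sum_univ_four]
      ring
    rw [e]
    simp only [h0, mul_zero, Finset.sum_const_zero]
  obtain ⟨k, l, hkl⟩ := key
  have hne : k ≠ l := by
    rintro rfl
    simp at hkl
  refine ⟨EuclideanSpace.single k 1, EuclideanSpace.single l 1, by simp, by simp, ?_, ?_⟩
  · simp [EuclideanSpace.inner_single_left, hne]
  · simpa [EuclideanSpace.inner_single_left, EuclideanSpace.inner_single_right, inner_sub_right,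
      real_inner_smul_right] using hkl

lemma IsGradient.exists_inner_eq (hm : IsGradient b m) {r : Fin 4 → ℝ} (hr : ∑ i, r i = 0) :
    ∃ a, ∀ i, ⟪m i, a⟫_ℝ = r i := by
  refine ⟨∑ j, r j • b j, fun i => ?_⟩
  have h : ∀ j, ⟪m i, b j⟫_ℝ = (if i = j then 1 else 0) - b.coord i 0 := fun j => by
    rw [← b.coord_apply, ← hm i (b j) 0, sub_zero]
  simp only [inner_sum, real_inner_smul_right, h, mul_sub, Finset.sum_sub_distrib,
    ← Finset.sum_mul, hr]
  simp

lemma balanced_of_immobilizes (hm : IsGradient b m) (hx : OnFaces b x)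
    (h : Immobilizes3 {x 0, x 1, x 2, x 3} (convexHull ℝ (Set.range b))) :
    MomentBalanced x m := by
  by_contra hnb
  obtain ⟨p, q, hp, hq, hpq, hneg⟩ := exists_orthonormal_pair hnb
  obtain ⟨ε, hε, hmove⟩ := h
  obtain ⟨τ, hτ⟩ : ∃ τ : Fin 4 → ℝ, ∀ i, τ i = ⟪m i, ⟪p, x i⟫_ℝ • q - ⟪q, x i⟫_ℝ • p⟫_ℝ :=
    ⟨_, fun _ => rfl⟩
  obtain ⟨β, hβ⟩ : ∃ β : Fin 4 → ℝ, ∀ i, β i = ⟪m i, ⟪p, x i⟫_ℝ • p + ⟪q, x i⟫_ℝ • q⟫_ℝ :=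
    ⟨_, fun _ => rfl⟩
  simp only [← hτ] at hneg
  obtain ⟨s, hs⟩ : ∃ s, s = (∑ i, τ i) / 4 := ⟨_, rfl⟩
  have hs0 : s < 0 := by linarith
  obtain ⟨a, ha⟩ := hm.exists_inner_eq (r := fun i => s - τ i) (by
    rw [Finset.sum_sub_distrib, hs]
    simp
    ring)
  have hev : ∀ᶠ φ in nhdsWithin (0 : ℝ) (Set.Ioi 0), 0 < sin φ ∧
      (2 * |sin (-(2 * φ))| + 2 * |1 - cos (-(2 * φ))| < ε ∧ |sin (2 * φ)| * ‖a‖ < ε ∧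
        ∀ i, cos φ * s - sin φ * β i < 0) := by
    refine Filter.Eventually.and ?_ (Filter.Eventually.filter_mono nhdsWithin_le_nhds
      (Filter.Eventually.and ?_ (Filter.Eventually.and ?_ (Filter.eventually_all.2 fun i => ?_))))
    · filter_upwards [Ioo_mem_nhdsGT Real.pi_pos] with φ hφ using sin_pos_of_mem_Ioo hφ
    · have hc : Continuous fun φ : ℝ => 2 * |sin (-(2 * φ))| + 2 * |1 - cos (-(2 * φ))| := by
        fun_prop
      exact (hc.tendsto 0).eventually (gt_mem_nhds (by simpa using hε))
    · have hc : Continuous fun φ : ℝ => |sin (2 * φ)| * ‖a‖ := by fun_prop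
      exact (hc.tendsto 0).eventually (gt_mem_nhds (by simpa using hε))
    · have hc : Continuous fun φ : ℝ => cos φ * s - sin φ * β i := by fun_prop
      exact (hc.tendsto 0).eventually (gt_mem_nhds (by simpa using hs0))
  obtain ⟨φ, hφ, hρε, haε, hlt⟩ := hev.exists
  obtain ⟨ρ, hdet, hρ, hρs⟩ := exists_planeRot_equiv hp hq hpq (2 * φ)
  have hcoord : ∀ i, b.coord i (ρ.symm (x i - -ρ (sin (2 * φ) • a))) < 0 := fun i => by
    rw [sub_neg_eq_add, map_add, ρ.symm_apply_apply, hρs, planeRot_apply, add_sub_assoc, add_assoc,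
      hm.coord_add, (hx i).1, inner_add_right, inner_sub_right, real_inner_smul_right,
      real_inner_smul_right, real_inner_smul_right, ha, ← hτ, ← hβ]
    have h1 := mul_neg_of_pos_of_neg hφ (hlt i)
    have h2 := cos_sq' φ
    rw [sin_two_mul, cos_two_mul, h2]
    linarith
  obtain ⟨y, hy, hin⟩ := hmove ρ (-ρ (sin (2 * φ) • a)) hdet
    (fun y => by
      rw [hρ]
      exact (norm_planeRot_sub_le hp hq _ y).trans
        (mul_le_mul_of_nonneg_right hρε.le (norm_nonneg y)))
    (by rwa [norm_neg, ρ.norm_map, norm_smul, Real.norm_eq_abs])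
    (by
      by_contra! hid
      have h1 := hcoord 0
      conv at h1 =>
        lhs
        rw [← hid (x 0), add_sub_cancel_right, ρ.symm_apply_apply, (hx 0).1]
      exact lt_irrefl _ h1)
  rw [mem_interior_image_iff] at hin
  rcases hy with rfl | rfl | rfl | rfl
  · exact lt_asymm (hin 0) (hcoord 0)
  · exact lt_asymm (hin 1) (hcoord 1)
  · exact lt_asymm (hin 2) (hcoord 2)
  · exact lt_asymm (hin 3) (hcoord 3)

end tetrahedron

/-- **Theorem 3 (immobilizing a tetrahedron).**  Four points `x i`, one in the relative
interior of each face of a tetrahedron `T` with vertices `B 0, …, B 3`, with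
directionally independent normal lines `lineTh (x i) (d i)` (where `d i ⊥` the face
containing `x i`), immobilize `T` if and only if the four normal lines belong
generically to one ruling of a quadric surface. -/
theorem immobilize_tetrahedron_iff
    (B : Fin 4 → V3) (hB : AffineIndependent ℝ B)
    (x d : Fin 4 → V3)
    (hx : ∀ i : Fin 4, x i ∈ intrinsicInterior ℝ (convexHull ℝ (B '' {i}ᶜ)))
    (hd : ∀ i, d i ≠ 0)
    (hperp : ∀ i j : Fin 4, j ≠ i → ⟪d i, B j - x i⟫_ℝ = 0)
    (hind : DirIndep d) :
    Immobilizes3 {x 0, x 1, x 2, x 3} (convexHull ℝ (Set.range B)) ↔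
      GenOneRuling x d := by
  have htop : affineSpan ℝ (Set.range B) = ⊤ := by
    rw [hB.affineSpan_eq_top_iff_card_eq_finrank_add_one]
    simp
  obtain ⟨b, hb⟩ : ∃ b : AffineBasis (Fin 4) ℝ V3, ⇑b = B := ⟨⟨B, hB, htop⟩, rfl⟩
  subst hb
  obtain ⟨m, hm⟩ := exists_isGradient b
  have hf : OnFaces b x := fun i => coord_of_mem_intrinsicInterior (hx i)
  have hline : ∀ i, lineTh (x i) (d i) = lineTh (x i) (m i) := fun i => by
    have h := hm.normal_eq_smul (hperp i)
    have hc : ⟪d i, b i - x i⟫_ℝ ≠ 0 := fun h0 => hd i (by rw [h, h0, zero_smul])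
    rw [h, lineTh_smul _ _ hc]
  have hgen : GenOneRuling x d ↔ GenOneRuling x m := by
    simp only [GenOneRuling, hline]
  rw [hgen, genOneRuling_iff_momentBalanced hm.closedFrame]
  exact ⟨balanced_of_immobilizes hm hf, immobilizes_of_balanced hm hf⟩
end
end
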